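/- arXiv:math/9808118 — 2 statements merged into one kernel-verified Lean document; each statement's English description precedes it below -/
import Mathlib

section
/- Let r ≥ 1 and c, p be nonnegative integers with c ≥ p. Then, for every number N of variables and all x = (x_1,…,x_N), one has s((c^{r−1}, c−p); x) = Σ_ν sp(ν; x), where the sum ranges over all partitions ν ⊆ (c^r) with oddcols((c^r)/ν) = p. -/
open scoped Classical
open Finset

noncomputable section

/-- Complete homogeneous symmetric polynomial of degree `m` in the variables `x`
(`0` for negative `m`). -/
def hpoly {R : Type} [CommRing R] {N : ℕ} (x : Fin N → R) (m : ℤ) : R :=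
  if 0 ≤ m then
    ∑ f ∈ Finset.univ.filter (fun f : Fin m.toNat → Fin N => Monotone f), ∏ i, x (f i)
  else 0

/-- The Schur function `s(λ; x) = det(h_{λ_i-i+j})` (indices `1 ≤ i,j ≤ r`). -/
def schur {R : Type} [CommRing R] {N r : ℕ} (lam : Fin r → ℤ) (x : Fin N → R) : R :=
  Matrix.det (Matrix.of fun i j : Fin r =>
    hpoly x (lam i - ((i : ℕ) : ℤ) + ((j : ℕ) : ℤ)))

/-- The formal symplectic character `sp(λ; x)`. -/
def spChar {R : Type} [CommRing R] {N r : ℕ} (lam : Fin r → ℤ) (x : Fin N → R) : R :=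
  Matrix.det (Matrix.of fun i j : Fin r =>
    if (j : ℕ) = 0 then hpoly x (lam i - ((i : ℕ) : ℤ))
    else hpoly x (lam i - ((i : ℕ) : ℤ) + ((j : ℕ) : ℤ)) +
      hpoly x (lam i - ((i : ℕ) : ℤ) - ((j : ℕ) : ℤ)))

/-- The number of odd columns of the skew shape `(C^n)/ν`. -/
def oddColsCount {n : ℕ} (C : ℕ) (ν : Fin n → ℕ) : ℕ :=
  ((Finset.range C).filter
    (fun j => Odd ((Finset.univ.filter (fun i : Fin n => ν i < j + 1)).card))).card


open Matrix

lemma prod_erase_ite {ι K : Type*} [Fintype ι] [DecidableEq ι] [CommMonoid K] (i : ι) (g : ι → K) :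
    ∏ j ∈ Finset.univ.erase i, g j = ∏ j, if j = i then 1 else g j := by
  rw [← Finset.mul_prod_erase Finset.univ (fun j => if j = i then 1 else g j) (Finset.mem_univ i)]
  rw [if_pos rfl, one_mul]
  exact Finset.prod_congr rfl fun j hj => by rw [if_neg (Finset.ne_of_mem_erase hj)]

lemma prod_neg_fin {K : Type*} [CommRing K] {n : ℕ} (g : Fin n → K) :
    ∏ i, (- g i) = (-1) ^ n * ∏ i, g i := by
  rw [Finset.prod_neg]; simp

lemma lagrange_field {K : Type*} [Field K] [CharZero K] {n : ℕ} (y : Fin (n + 1) → K) (t : K)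
    (hinj : Function.Injective y) (h0 : ∀ i, y i ≠ 0) (h1 : ∀ i, y i ≠ 1) (h2 : ∀ i, y i ≠ -1) :
    ∑ k, (1 - t * y k) * (∏ i : Fin n, (y (k.succAbove i) * (1 - y (k.succAbove i) * y k)
      / (y (k.succAbove i) - y k))) = 1 - (if Odd (n + 1) then t else 1) * ∏ i, y i := by
  classical
  let v : Fin (n + 1) ⊕ Fin 3 → K := Sum.elim y ![0, 1, -1]
  have hv : Function.Injective v := by
    refine hinj.sumElim ?_ ?_
    · intro a b hab
      fin_cases a <;> fin_cases b <;> simp at hab ⊢ <;> norm_num at hab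
    · intro a b
      fin_cases b <;> simp [h0, h1, h2]
  let P : Polynomial K := (∏ i, (1 - Polynomial.C (y i) * Polynomial.X)) *
    (1 - Polynomial.C t * Polynomial.X)
  have hdeg1 : ∀ a : K, (1 - Polynomial.C a * Polynomial.X).natDegree ≤ 1 := by
    intro a
    compute_degree
  have hPn : P.natDegree ≤ n + 2 := by
    refine (Polynomial.natDegree_mul_le).trans ?_
    have := Polynomial.natDegree_prod_le Finset.univ
      (fun i => (1 - Polynomial.C (y i) * Polynomial.X))
    have h3 : ∑ i, (1 - Polynomial.C (y i) * Polynomial.X).natDegree ≤ ∑ i : Fin (n+1), 1 :=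
      Finset.sum_le_sum fun i _ => hdeg1 _
    have := hdeg1 t
    simp at h3
    omega
  have hP : P.degree < (Finset.univ : Finset (Fin (n + 1) ⊕ Fin 3)).card := by
    refine lt_of_le_of_lt Polynomial.degree_le_natDegree ?_
    simp only [Finset.card_univ, Fintype.card_sum, Fintype.card_fin]
    exact_mod_cast (by omega)
  have key := Lagrange.coeff_eq_sum (s := Finset.univ) (v := v) hv.injOn hP
  rw [Polynomial.coeff_eq_zero_of_natDegree_lt (by simp; omega)] at key
  simp only [prod_erase_ite, Fintype.sum_sum_type, Fintype.prod_sum_type, Fin.sum_univ_three,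
    Fin.prod_univ_three] at key
  simp only [v, P, Sum.elim_inl, Sum.elim_inr, Polynomial.eval_mul, Polynomial.eval_prod,
    Polynomial.eval_sub, Polynomial.eval_one, Polynomial.eval_C, Polynomial.eval_X] at key
  simp at key
  have e1 : (∏ x, (1 - y x)) ≠ 0 := Finset.prod_ne_zero_iff.2 fun i _ => sub_ne_zero.2 (h1 i).symm
  have e2 : (∏ x, (-1 - y x)) ≠ 0 := Finset.prod_ne_zero_iff.2 fun i _ =>
    sub_ne_zero.2 (h2 i).symm
  have e0 : (∏ x, y x) ≠ 0 := Finset.prod_ne_zero_iff.2 fun i _ => h0 i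
  have e3 : (∏ x, (1 + y x)) = (-1) ^ (n + 1) * (∏ x, (-1 - y x)) := by
    rw [← prod_neg_fin]
    exact Finset.prod_congr rfl fun i _ => by ring
  have e4 : ∀ k, (1 - t * y k) * (∏ i : Fin n, (y (k.succAbove i) * (1 - y (k.succAbove i) * y k)
      / (y (k.succAbove i) - y k))) = (- (-1) ^ n * ∏ x, y x) *
      ((∏ x, (1 - y x * y k)) * (1 - t * y k) /
      ((∏ x, if x = k then 1 else y k - y x) * (y k * (y k - 1) * (y k + 1)))) := by
    intro k
    rw [Fin.prod_univ_succAbove _ k, Fin.prod_univ_succAbove _ k, Fin.prod_univ_succAbove _ k]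
    simp only [if_true, Fin.succAbove_ne, if_false, Finset.prod_div_distrib, Finset.prod_mul_distrib]
    have e5 : ∏ i, (y (k.succAbove i) - y k) = (-1) ^ n * ∏ i, (y k - y (k.succAbove i)) := by
      rw [← prod_neg_fin]
      exact Finset.prod_congr rfl fun i _ => by ring
    rw [e5]
    have e6 : ∏ i, (y k - y (k.succAbove i)) ≠ 0 := Finset.prod_ne_zero_iff.2 fun i _ =>
      sub_ne_zero.2 (fun h => Fin.succAbove_ne k i (hinj h).symm)
    have := h0 k
    have := sub_ne_zero.2 (h1 k)
    have h7 : y k + 1 ≠ 0 := fun h => h2 k (eq_neg_of_add_eq_zero_left h)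
    rcases neg_one_pow_eq_or K n with h | h <;> rw [h] <;> field_simp <;> ring
  rw [Finset.sum_congr rfl fun k _ => e4 k, ← Finset.mul_sum]
  rw [prod_neg_fin, e3] at key
  have key2 := (eq_neg_of_add_eq_zero_left key.symm)
  rw [key2]
  rcases Nat.even_or_odd n with h | h
  · rw [if_pos h.add_one, pow_succ, h.neg_one_pow]
    field_simp
    ring
  · rw [if_neg (by simpa using h.add_one), pow_succ, h.neg_one_pow]
    field_simp
    ring

lemma vandermonde_succAbove {B : Type*} [CommRing B] {n : ℕ} (y : Fin (n + 1) → B) (k : Fin (n + 1)) :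
    (vandermonde y).det = (-1) ^ (k : ℕ) * (∏ i, (y (k.succAbove i) - y k)) *
      (vandermonde (y ∘ k.succAbove)).det := by
  have h := det_permute k.cycleRange.symm (vandermonde y)
  rw [Equiv.Perm.sign_symm, Fin.sign_cycleRange] at h
  have h2 : (vandermonde y).submatrix k.cycleRange.symm id = vandermonde (y ∘ k.cycleRange.symm) := by
    ext i j; simp [vandermonde_apply]
  have h3 : (vandermonde (y ∘ k.cycleRange.symm)).det = (∏ i, (y (k.succAbove i) - y k)) *
      (vandermonde (y ∘ k.succAbove)).det := by
    rw [det_vandermonde, det_vandermonde, Fin.prod_univ_succ]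
    congr 1
    · simp [Fin.Ioi_zero_eq_map]
    · simp [- Fin.map_succEmb_Ioi, Fin.Ioi_succ]
  rw [mul_assoc, ← h3, ← h2, h]
  push_cast
  rw [← mul_assoc, ← pow_add, Even.neg_one_pow ⟨_, rfl⟩, one_mul]

lemma key_field {K : Type*} [Field K] [CharZero K] {n : ℕ} (y : Fin (n + 1) → K) (t : K)
    (hinj : Function.Injective y) (h0 : ∀ i, y i ≠ 0) (h1 : ∀ i, y i ≠ 1) (h2 : ∀ i, y i ≠ -1) :
    ∑ k : Fin (n + 1), (-1) ^ (k : ℕ) * ((1 - t * y k) * ∏ i : Fin n, (y (k.succAbove i) *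
      (1 - y (k.succAbove i) * y k))) * (vandermonde (y ∘ k.succAbove)).det =
      (vandermonde y).det * (1 - (if Odd (n + 1) then t else 1) * ∏ i, y i) := by
  rw [← lagrange_field y t hinj h0 h1 h2, Finset.mul_sum]
  refine Finset.sum_congr rfl fun k _ => ?_
  rw [vandermonde_succAbove y k, Finset.prod_div_distrib]
  have e6 : ∏ i, (y (k.succAbove i) - y k) ≠ 0 := Finset.prod_ne_zero_iff.2 fun i _ =>
      sub_ne_zero.2 (fun h => Fin.succAbove_ne k i (hinj h))
  field_simp

lemma key_id {B : Type*} [CommRing B] {n : ℕ} (y : Fin (n + 1) → B) (t : B) :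
    ∑ k : Fin (n + 1), (-1) ^ (k : ℕ) * ((1 - t * y k) * ∏ i : Fin n, (y (k.succAbove i) *
      (1 - y (k.succAbove i) * y k))) * (vandermonde (y ∘ k.succAbove)).det =
      (vandermonde y).det * (1 - (if Odd (n + 1) then t else 1) * ∏ i, y i) := by
  let P := MvPolynomial (Option (Fin (n + 1))) ℤ
  let Y : Fin (n + 1) → P := fun i => MvPolynomial.X (some i)
  let T : P := MvPolynomial.X none
  have hP : ∑ k : Fin (n + 1), (-1) ^ (k : ℕ) * ((1 - T * Y k) * ∏ i : Fin n, (Y (k.succAbove i) *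
      (1 - Y (k.succAbove i) * Y k))) * (vandermonde (Y ∘ k.succAbove)).det =
      (vandermonde Y).det * (1 - (if Odd (n + 1) then T else 1) * ∏ i, Y i) := by
    let K := FractionRing P
    have hinjK : Function.Injective (algebraMap P K) := IsFractionRing.injective P K
    have : CharZero K := charZero_of_injective_algebraMap hinjK
    apply hinjK
    have hev : ∀ (i : Fin (n + 1)) (a : ℤ), Y i ≠ MvPolynomial.C a := by
      intro i a h
      have h1 := congrArg (MvPolynomial.eval (fun _ => a + 1)) h
      simp [Y] at h1
    have h := key_field (fun i => algebraMap P K (Y i)) (algebraMap P K T)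
      (fun a b hab => Option.some_injective _ (MvPolynomial.X_injective (hinjK hab)))
      (fun i hi => hev i 0 (hinjK (by simpa using hi)))
      (fun i hi => hev i 1 (hinjK (by simpa using hi)))
      (fun i hi => hev i (-1) (hinjK (by simpa using hi)))
    simp only [det_vandermonde] at h ⊢
    simp only [map_sum, map_mul, map_prod, map_sub, map_one, map_pow, map_neg, apply_ite (algebraMap P K),
      Function.comp_apply] at h ⊢
    exact h
  have h := congrArg (MvPolynomial.eval₂Hom (Int.castRingHom B) (fun o => o.elim t y)) hP
  simp only [det_vandermonde] at h ⊢
  simp only [map_sum, map_mul, map_prod, map_sub, map_one, map_pow, map_neg,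
      Function.comp_apply] at h ⊢
  split_ifs at h ⊢ <;> simpa [Y, T] using h

/-- number of odd columns of the partition `μ` -/
def oc {n : ℕ} (M : ℕ) (μ : Fin n → ℕ) : ℕ :=
  ((Finset.range M).filter
    (fun j => Odd ((Finset.univ.filter (fun i : Fin n => j < μ i)).card))).card

/-- monotone sequences with entries `< M` -/
def monos (M n : ℕ) : Finset (Fin n → ℕ) :=
  (Fintype.piFinset fun _ : Fin n => Finset.range M).filter Monotone

lemma mem_monos {M n : ℕ} {μ : Fin n → ℕ} : μ ∈ monos M n ↔ (∀ i, μ i < M) ∧ Monotone μ := by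
  simp [monos]

/-- alternant -/
def alt {B : Type*} [CommRing B] {n : ℕ} (y : Fin n → B) (l : Fin n → ℕ) : B :=
  (Matrix.of fun i j => y i ^ l j).det

lemma oc_cons {n : ℕ} (M : ℕ) (μ : Fin n → ℕ) :
    oc M (Fin.cons 0 μ : Fin (n + 1) → ℕ) = oc M μ := by
  unfold oc
  congr 1
  refine Finset.filter_congr fun j _ => ?_
  rw [Finset.card_filter, Finset.card_filter, Fin.sum_univ_succ]
  simp

lemma oc_succ {n : ℕ} (M : ℕ) (μ : Fin (n + 1) → ℕ) (h : ∀ i, μ i < M) :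
    oc M (fun i => μ i + 1) = oc M μ + (if Odd (n + 1) then 1 else 0) := by
  unfold oc
  obtain ⟨M, rfl⟩ : ∃ k, M = k + 1 := ⟨M - 1, by have := h 0; omega⟩
  rw [Finset.card_filter, Finset.card_filter, Finset.sum_range_succ', Finset.sum_range_succ _ M]
  have : (Finset.univ.filter (fun i : Fin (n + 1) => M < μ i)).card = 0 := by
    rw [Finset.card_eq_zero, Finset.filter_eq_empty_iff]
    intro i _
    have := h i
    omega
  simp [this]

lemma alt_succ {B : Type*} [CommRing B] {n : ℕ} (y : Fin n → B) (l : Fin n → ℕ) :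
    alt y (fun j => l j + 1) = (∏ i, y i) * alt y l := by
  unfold alt
  rw [← det_mul_column]
  congr 1
  ext i j
  simp [pow_succ']

lemma alt_zero_of_le {B : Type*} [CommRing B] {n M : ℕ} (y : Fin n → B) (hy : ∀ i, y i ^ M = 0)
    (l : Fin n → ℕ) (j : Fin n) (hj : M ≤ l j) : alt y l = 0 := by
  apply Matrix.det_eq_zero_of_column_eq_zero j
  intro i
  simp [pow_eq_zero_of_le hj (hy i)]

/-- Littlewood sum -/
def Lsum {B : Type*} [CommRing B] {n : ℕ} (M : ℕ) (t : B) (y : Fin n → B) : B :=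
  ∑ μ ∈ monos M n, t ^ oc M μ * alt y (fun j => μ j + j)

lemma Lsum_step {B : Type*} [CommRing B] {n : ℕ} (M : ℕ) (t : B) (y : Fin (n + 1) → B)
    (hy : ∀ i, y i ^ M = 0) :
    Lsum M t y * (1 - (if Odd (n + 1) then t else 1) * ∏ i, y i) =
      ∑ k : Fin (n + 1), (-1) ^ (k : ℕ) * (∏ i, y (k.succAbove i)) * Lsum M t (y ∘ k.succAbove) := by
  rcases Nat.eq_zero_or_pos M with rfl | hM
  · have : (1 : B) = 0 := by simpa using hy 0
    have := subsingleton_of_zero_eq_one this.symm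
    exact Subsingleton.elim _ _
  have hsplit := Finset.sum_filter_add_sum_filter_not (monos M (n + 1)) (fun μ => μ 0 = 0)
    (fun μ => t ^ oc M μ * alt y (fun j => μ j + j))
  have hpos : ∑ μ ∈ (monos M (n + 1)).filter (fun μ => ¬ μ 0 = 0),
      t ^ oc M μ * alt y (fun j => μ j + j) =
      Lsum M t y * ((if Odd (n + 1) then t else 1) * ∏ i, y i) := by
    have himg : ∑ μ ∈ (monos M (n + 1)).image (fun μ i => μ i + 1),
      t ^ oc M μ * alt y (fun j => μ j + j) =
      Lsum M t y * ((if Odd (n + 1) then t else 1) * ∏ i, y i) := by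
      rw [Finset.sum_image, Lsum, Finset.sum_mul]
      · refine Finset.sum_congr rfl fun μ hμ => ?_
        rw [mem_monos] at hμ
        rw [oc_succ M μ hμ.1]
        have := alt_succ y (fun j => μ j + j)
        have e : (fun j : Fin (n + 1) => μ j + 1 + (j : ℕ)) = fun j => μ j + j + 1 := by
          funext j; ring
        rw [e, this, pow_add]
        split_ifs <;> simp <;> ring
      · intro a _ b _ hab
        funext i
        simpa using congrFun hab i
    rw [← himg]
    refine Finset.sum_subset ?_ ?_
    · intro μ hμ
      rw [Finset.mem_filter, mem_monos] at hμ
      obtain ⟨⟨h1, h2⟩, h3⟩ := hμ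
      rw [Finset.mem_image]
      have h4 : ∀ i, 1 ≤ μ i := fun i => by have := h2 (Fin.zero_le i); omega
      refine ⟨fun i => μ i - 1, mem_monos.2 ⟨fun i => ?_, fun a b hab => ?_⟩, ?_⟩
      · have := h1 i; omega
      · have := h2 hab; simp only; omega
      · funext i; have := h4 i; simp only; omega
    · intro μ hμ hμ2
      rw [Finset.mem_image] at hμ
      obtain ⟨κ, hκ, rfl⟩ := hμ
      rw [mem_monos] at hκ
      have : ∃ j, M ≤ κ j + 1 := by
        by_contra! hcon
        apply hμ2
        rw [Finset.mem_filter, mem_monos]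
        refine ⟨⟨hcon, fun a b hab => ?_⟩, by simp⟩
        have := hκ.2 hab; simp only; omega
      obtain ⟨j, hj⟩ := this
      rw [alt_zero_of_le y hy _ j (by simp only; omega), mul_zero]
  have hzero : ∑ μ ∈ (monos M (n + 1)).filter (fun μ => μ 0 = 0),
      t ^ oc M μ * alt y (fun j => μ j + j) =
      ∑ k : Fin (n + 1), (-1) ^ (k : ℕ) * (∏ i, y (k.succAbove i)) * Lsum M t (y ∘ k.succAbove) := by
    have himg : (monos M (n + 1)).filter (fun μ => μ 0 = 0) =
        (monos M n).image (fun μ => (Fin.cons 0 μ : Fin (n + 1) → ℕ)) := by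
      ext μ
      simp only [Finset.mem_filter, mem_monos, Finset.mem_image]
      constructor
      · rintro ⟨⟨h1, h2⟩, h3⟩
        refine ⟨fun i => μ i.succ, ⟨fun i => h1 _, fun a b hab => h2 (by simpa using hab)⟩, ?_⟩
        funext i
        refine Fin.cases ?_ (fun i => ?_) i <;> simp [h3]
      · rintro ⟨κ, ⟨h1, h2⟩, rfl⟩
        refine ⟨⟨fun i => ?_, fun a b => ?_⟩, by simp⟩
        · refine Fin.cases ?_ (fun i => ?_) i <;> simp [h1, hM]
        · refine Fin.cases ?_ (fun a => ?_) a <;> refine Fin.cases ?_ (fun b => ?_) b <;> simp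
          intro h; exact h2 h
    rw [himg, Finset.sum_image (fun a _ b _ hab => by
      funext i; simpa using congrFun hab i.succ)]
    simp only [Lsum, Finset.mul_sum]
    rw [Finset.sum_comm]
    refine Finset.sum_congr rfl fun μ _ => ?_
    rw [oc_cons]
    conv_lhs => rw [alt, det_succ_column_zero, Finset.mul_sum]
    refine Finset.sum_congr rfl fun k _ => ?_
    have e : (Matrix.of fun i j => y i ^ ((Fin.cons 0 μ : Fin (n + 1) → ℕ) j + (j : ℕ))).submatrix
        k.succAbove Fin.succ = Matrix.of fun i j => (y ∘ k.succAbove) i ^ (μ j + j + 1) := by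
      ext i j
      simp [add_assoc]
    have := alt_succ (y ∘ k.succAbove) (fun j => μ j + j)
    unfold alt at this
    rw [e, this, alt]
    simp
    ring
  have : Lsum M t y = ∑ μ ∈ monos M (n + 1), t ^ oc M μ * alt y (fun j => μ j + j) := rfl
  rw [mul_sub, mul_one, ← hpos, ← hzero, this, ← hsplit]
  ring

/-- `∏_{i<j} (1 - y_i y_j)` -/
def pairProd {B : Type*} [CommRing B] {n : ℕ} (y : Fin n → B) : B :=
  ∏ i, ∏ j ∈ Finset.Ioi i, (1 - y i * y j)

lemma pairProd_succAbove {B : Type*} [CommRing B] {n : ℕ} (y : Fin (n + 1) → B) (k : Fin (n + 1)) :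
    pairProd y = (∏ i, (1 - y (k.succAbove i) * y k)) * pairProd (y ∘ k.succAbove) := by
  have h : ∀ {m : ℕ} (z : Fin m → B), pairProd z = ∏ i, ∏ j, if i < j then (1 - z i * z j) else 1 := by
    intro m z
    unfold pairProd
    refine Finset.prod_congr rfl fun i _ => ?_
    rw [← Finset.prod_filter]
    refine Finset.prod_congr ?_ fun _ _ => rfl
    ext j; simp
  rw [h, h, Fin.prod_univ_succAbove _ k, Fin.prod_univ_succAbove _ k, if_neg (lt_irrefl _), one_mul]
  simp only [Fin.prod_univ_succAbove _ k, Finset.prod_mul_distrib]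
  rw [← mul_assoc, ← Finset.prod_mul_distrib]
  congr 1
  · refine Finset.prod_congr rfl fun i _ => ?_
    rcases lt_or_gt_of_ne (Fin.succAbove_ne k i) with h1 | h1
    · rw [if_neg (not_lt_of_gt h1), if_pos h1, one_mul]
    · rw [if_pos h1, if_neg (not_lt_of_gt h1), mul_one, mul_comm]
  · refine Finset.prod_congr rfl fun i _ => Finset.prod_congr rfl fun j _ => ?_
    simp [(Fin.strictMono_succAbove k).lt_iff_lt]

theorem littlewood {B : Type*} [CommRing B] {n : ℕ} (M : ℕ) (t : B) (y : Fin n → B)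
    (hy : ∀ i, y i ^ M = 0) :
    Lsum M t y * (∏ i, (1 - t * y i)) * pairProd y = (vandermonde y).det := by
  induction n with
  | zero =>
    have : monos M 0 = {fun i => i.elim0} := by
      ext μ
      simp only [mem_monos, Finset.mem_singleton]
      exact ⟨fun _ => Subsingleton.elim _ _, fun _ => ⟨fun i => i.elim0, fun i => i.elim0⟩⟩
    simp [Lsum, this, oc, alt, pairProd]
  | succ n ih =>
    have hu : IsUnit (1 - (if Odd (n + 1) then t else 1) * ∏ i, y i) := by
      apply IsNilpotent.isUnit_one_sub
      refine ⟨M, ?_⟩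
      rw [mul_pow, ← Finset.prod_pow, Fin.prod_univ_succ, hy]
      simp
    apply hu.mul_right_cancel
    rw [← key_id]
    have := Lsum_step M t y hy
    calc _ = (Lsum M t y * (1 - (if Odd (n + 1) then t else 1) * ∏ i, y i)) *
          ((∏ i, (1 - t * y i)) * pairProd y) := by ring
      _ = _ := by
        rw [this, Finset.sum_mul]
        refine Finset.sum_congr rfl fun k _ => ?_
        rw [← ih (y ∘ k.succAbove) (fun i => hy _), pairProd_succAbove y k,
          Fin.prod_univ_succAbove _ k, Finset.prod_mul_distrib]
        simp only [Function.comp_apply]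
        ring

/-- exponents of the shape `(p)` plus staircase -/
def hook (n p : ℕ) (j : Fin (n + 1)) : ℕ := (j : ℕ) + if j = Fin.last n then p else 0

lemma hook_sum {B : Type*} [CommRing B] {n : ℕ} (M : ℕ) (t : B) (y : Fin (n + 1) → B)
    (hy : ∀ i, y i ^ M = 0) :
    (∑ p ∈ Finset.range M, t ^ p * alt y (hook n p)) * (∏ i, (1 - t * y i)) =
      (vandermonde y).det := by
  let w : Fin (n + 1) → B := fun i => ∑ p ∈ Finset.range M, t ^ p * y i ^ (n + p)
  have hw : ∀ i, (1 - t * y i) * w i = y i ^ n := by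
    intro i
    have h1 := mul_neg_geom_sum (t * y i) M
    have h2 : w i = y i ^ n * ∑ p ∈ Finset.range M, (t * y i) ^ p := by
      simp only [w, Finset.mul_sum]
      refine Finset.sum_congr rfl fun p _ => ?_
      rw [mul_pow, pow_add]; ring
    rw [h2, mul_left_comm, h1, mul_pow, hy]
    simp
  have h1 : ∑ p ∈ Finset.range M, t ^ p * alt y (hook n p) =
      ((vandermonde y).updateCol (Fin.last n) w).det := by
    rw [← cramer_apply]
    have : w = ∑ p ∈ Finset.range M, t ^ p • fun i => y i ^ (n + p) := by
      funext i
      simp [w]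
    rw [this, map_sum, Finset.sum_apply]
    refine Finset.sum_congr rfl fun p _ => ?_
    rw [map_smul, Pi.smul_apply, cramer_apply, smul_eq_mul, alt]
    congr 2
    ext i j
    by_cases hj : j = Fin.last n
    · subst hj
      simp [hook]
    · simp [hook, hj, vandermonde_apply]
  rw [h1, mul_comm, ← det_mul_column, ← det_submatrix_equiv_self Fin.revPerm,
    ← det_submatrix_equiv_self Fin.revPerm (vandermonde y)]
  symm
  apply det_eq_of_forall_col_eq_smul_add_pred (fun _ => t)
  · intro i
    simp [vandermonde_apply, hw]
  · intro i j
    have hj : Fin.rev j.succ ≠ Fin.last n := by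
      intro h
      have := congrArg Fin.val h
      simp [Fin.val_rev] at this
      omega
    have e : n + 1 - ((j : ℕ) + 1) = (n + 1 - ((j : ℕ) + 1 + 1)) + 1 := by omega
    simp only [submatrix_apply, Fin.revPerm_apply, of_apply, vandermonde_apply, updateCol_apply,
      if_neg hj, Fin.val_rev, Fin.val_succ, Fin.val_castSucc]
    rw [e]
    ring

lemma alt_map {B B' : Type*} [CommRing B] [CommRing B'] (f : B →+* B') {n : ℕ} (y : Fin n → B)
    (l : Fin n → ℕ) : alt (fun i => f (y i)) l = f (alt y l) := by
  unfold alt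
  rw [RingHom.map_det]
  congr 1
  ext i j
  simp

lemma littlewood_coeff {B : Type*} [CommRing B] {n : ℕ} (M p : ℕ) (hp : p < M) (y : Fin (n + 1) → B)
    (hy : ∀ i, y i ^ M = 0) :
    (∑ μ ∈ (monos M (n + 1)).filter (fun μ => oc M μ = p), alt y (fun j => μ j + j)) * pairProd y =
      alt y (hook n p) := by
  let y' : Fin (n + 1) → Polynomial B := fun i => Polynomial.C (y i)
  have hy' : ∀ i, y' i ^ M = 0 := fun i => by simp [y', ← Polynomial.C_pow, hy]
  have h1 := littlewood M Polynomial.X y' hy'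
  have h2 := hook_sum M Polynomial.X y' hy'
  have hu : IsUnit (∏ i, (1 - Polynomial.X * y' i)) := by
    rw [IsUnit.prod_univ_iff]
    intro i
    apply IsNilpotent.isUnit_one_sub
    exact ⟨M, by rw [mul_pow, hy', mul_zero]⟩
  have h3 : Lsum M Polynomial.X y' * pairProd y' =
      ∑ p ∈ Finset.range M, Polynomial.X ^ p * alt y' (hook n p) := by
    apply hu.mul_right_cancel
    rw [h2, ← h1]; ring
  have h4 : pairProd y' = Polynomial.C (pairProd y) := by
    simp [pairProd, y', map_prod]
  have h5 := congrArg (fun q => Polynomial.coeff q p) h3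
  simp only [Lsum, y', alt_map] at h5
  rw [show pairProd (fun i => Polynomial.C (y i)) = Polynomial.C (pairProd y) from h4] at h5
  simp only [Polynomial.coeff_mul_C, Polynomial.finsetSum_coeff, Polynomial.coeff_X_pow] at h5
  rw [Finset.sum_filter]
  simpa [eq_comm, hp] using h5

lemma littlewood_trunc {B : Type*} [CommRing B] {n : ℕ} (c p : ℕ) (hp : p ≤ c) (y : Fin (n + 1) → B)
    (hy : ∀ i, y i ^ (c + n + 1) = 0) :
    (∑ μ ∈ (monos (c + 1) (n + 1)).filter (fun μ => oc c μ = p), alt y (fun j => μ j + j)) *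
      pairProd y = alt y (hook n p) := by
  rw [← littlewood_coeff (c + n + 1) p (by omega) y hy]
  congr 1
  have hoc : ∀ μ : Fin (n + 1) → ℕ, (∀ i, μ i < c + 1) → oc (c + n + 1) μ = oc c μ := by
    intro μ hμ
    unfold oc
    congr 1
    ext j
    simp only [Finset.mem_filter, Finset.mem_range]
    constructor
    · rintro ⟨h1, h2⟩
      refine ⟨?_, h2⟩
      obtain ⟨i, hi⟩ := Finset.card_pos.1 h2.pos
      have := hμ i
      simp at hi
      omega
    · rintro ⟨h1, h2⟩
      exact ⟨by omega, h2⟩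
  refine Finset.sum_subset ?_ ?_
  · intro μ hμ
    rw [Finset.mem_filter, mem_monos] at hμ ⊢
    refine ⟨⟨fun i => ?_, hμ.1.2⟩, by rw [hoc μ hμ.1.1, hμ.2]⟩
    have := hμ.1.1 i
    omega
  · intro μ hμ hμ2
    rw [Finset.mem_filter, mem_monos] at hμ hμ2
    have : c + 1 ≤ μ (Fin.last n) := by
      by_contra hcon
      have h : ∀ i, μ i < c + 1 := fun i => by
        have := hμ.1.2 (Fin.le_last i); omega
      exact hμ2 ⟨⟨h, hμ.1.2⟩, by rw [← hoc μ h, hμ.2]⟩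
    apply alt_zero_of_le y hy _ (Fin.last n)
    simp; omega

/-- the evaluation functional -/
def evalFun {R : Type*} [CommRing R] {m : ℕ} (g : ℕ → R) : MvPolynomial (Fin m) R →ₗ[R] R :=
  (MvPolynomial.basisMonomials (Fin m) R).constr R (fun a => ∏ i, g (a i))

lemma evalFun_monomial {R : Type*} [CommRing R] {m : ℕ} (g : ℕ → R) (a : Fin m →₀ ℕ) (r : R) :
    evalFun g (MvPolynomial.monomial a r) = r * ∏ i, g (a i) := by
  have h : MvPolynomial.monomial a r = r • MvPolynomial.basisMonomials (Fin m) R a := by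
    simp [MvPolynomial.smul_monomial]
  rw [h, map_smul, evalFun, Module.Basis.constr_basis, smul_eq_mul]

lemma evalFun_prod {R : Type*} [CommRing R] {m : ℕ} (g : ℕ → R) (a : Fin m → ℕ) :
    evalFun g (∏ i, (MvPolynomial.X i : MvPolynomial (Fin m) R) ^ a i) = ∏ i, g (a i) := by
  have h : (∏ i, (MvPolynomial.X i : MvPolynomial (Fin m) R) ^ a i) =
      MvPolynomial.monomial (Finsupp.equivFunOnFinite.symm a) 1 := by
    rw [MvPolynomial.monomial_eq]
    simp [Finsupp.prod_fintype]
  rw [h, evalFun_monomial]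
  simp

lemma evalFun_ideal {R : Type*} [CommRing R] {m M : ℕ} (g : ℕ → R) (hg : ∀ a, M ≤ a → g a = 0)
    (f : MvPolynomial (Fin m) R)
    (hf : f ∈ Ideal.span (Set.range fun i : Fin m => (MvPolynomial.X i : MvPolynomial (Fin m) R) ^ M)) :
    evalFun g f = 0 := by
  obtain ⟨k, rfl⟩ := (Submodule.mem_span_range_iff_exists_fun _).1 hf
  rw [map_sum]
  refine Finset.sum_eq_zero fun i _ => ?_
  induction k i using MvPolynomial.induction_on' with
  | monomial a r =>
    rw [smul_eq_mul, MvPolynomial.X_pow_eq_monomial, MvPolynomial.monomial_mul, evalFun_monomial]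
    rw [Finset.prod_eq_zero (Finset.mem_univ i), mul_zero]
    apply hg
    simp
  | add p q hp hq => rw [add_smul, map_add, hp, hq, add_zero]

lemma evalFun_rename {R : Type*} [CommRing R] {m : ℕ} (g : ℕ → R) (σ : Equiv.Perm (Fin m))
    (f : MvPolynomial (Fin m) R) : evalFun g (MvPolynomial.rename σ f) = evalFun g f := by
  induction f using MvPolynomial.induction_on' with
  | monomial a r =>
    rw [MvPolynomial.rename_monomial, evalFun_monomial, evalFun_monomial]
    congr 1
    simp only [Finsupp.mapDomain_equiv_apply]
    exact Equiv.prod_comp σ.symm (fun i => g (a i))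
  | add p q hp hq => rw [map_add, map_add, map_add, hp, hq]

lemma evalFun_alt {R : Type*} [CommRing R] {m : ℕ} (g : ℕ → R) (A F : MvPolynomial (Fin m) R)
    (hA : ∀ σ : Equiv.Perm (Fin m), MvPolynomial.rename σ A = ((Equiv.Perm.sign σ : ℤ) : MvPolynomial (Fin m) R) * A) :
    (m.factorial : R) * evalFun g (A * F) = evalFun g (A * ∑ σ : Equiv.Perm (Fin m),
      ((Equiv.Perm.sign σ : ℤ) : MvPolynomial (Fin m) R) * MvPolynomial.rename σ F) := by
  rw [Finset.mul_sum, map_sum]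
  have : ∀ σ : Equiv.Perm (Fin m), evalFun g (A * (((Equiv.Perm.sign σ : ℤ) : MvPolynomial (Fin m) R) *
      MvPolynomial.rename σ F)) = evalFun g (A * F) := by
    intro σ
    rw [← evalFun_rename g σ (A * F), map_mul (MvPolynomial.rename σ), hA]
    congr 1; ring
  rw [Finset.sum_congr rfl fun σ _ => this σ]
  simp [Fintype.card_perm]

/-- product of the column polynomials -/
def colProd {B : Type*} [CommRing B] {m : ℕ} (S : Fin m → Finset ℕ) (y : Fin m → B) : B :=
  ∏ j, ∑ s ∈ S j, y j ^ s

/-- determinant of the column polynomials -/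
def colDet {B : Type*} [CommRing B] {m : ℕ} (S : Fin m → Finset ℕ) (y : Fin m → B) : B :=
  (Matrix.of fun i j => ∑ s ∈ S j, y i ^ s).det

lemma colProd_alt {R : Type*} [CommRing R] {m : ℕ} (S : Fin m → Finset ℕ) :
    ∑ σ : Equiv.Perm (Fin m), ((Equiv.Perm.sign σ : ℤ) : MvPolynomial (Fin m) R) *
      MvPolynomial.rename σ (colProd S MvPolynomial.X) = colDet S MvPolynomial.X := by
  rw [colDet, det_apply']
  simp [colProd, map_prod, map_sum]

lemma alt_rename {R : Type*} [CommRing R] {m : ℕ} (l : Fin m → ℕ) (σ : Equiv.Perm (Fin m)) :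
    MvPolynomial.rename σ (alt (MvPolynomial.X : Fin m → MvPolynomial (Fin m) R) l) =
      ((Equiv.Perm.sign σ : ℤ) : MvPolynomial (Fin m) R) * alt MvPolynomial.X l := by
  have h := alt_map (MvPolynomial.rename (R := R) σ).toRingHom MvPolynomial.X l
  have h2 := det_permute σ (Matrix.of fun i j => (MvPolynomial.X i : MvPolynomial (Fin m) R) ^ l j)
  unfold alt at *
  rw [← h2]
  refine h.symm.trans ?_
  congr 1
  ext1 i j
  simp

lemma det_eq_evalFun {R : Type*} [CommRing R] {m : ℕ} (g : ℕ → R) (l : Fin m → ℕ)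
    (S : Fin m → Finset ℕ) :
    (Matrix.of fun i j => ∑ s ∈ S j, g (l i + s)).det =
      evalFun g (alt MvPolynomial.X l * colProd S MvPolynomial.X) := by
  rw [alt, ← det_transpose (Matrix.of fun i j => (MvPolynomial.X i : MvPolynomial (Fin m) R) ^ l j),
    det_apply', det_apply', Finset.sum_mul, map_sum]
  refine Finset.sum_congr rfl fun σ _ => ?_
  simp only [of_apply, transpose_apply, colProd]
  rw [mul_assoc, ← Finset.prod_mul_distrib]
  simp only [Finset.mul_sum, ← pow_add]
  rw [Finset.prod_univ_sum, Finset.prod_univ_sum]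
  have : ∀ f : MvPolynomial (Fin m) R, ((Equiv.Perm.sign σ : ℤ) : MvPolynomial (Fin m) R) * f =
      ((Equiv.Perm.sign σ : ℤ) : R) • f := by
    intro f
    rw [MvPolynomial.smul_eq_C_mul]; simp
  rw [this, map_smul, map_sum, smul_eq_mul]
  congr 1
  refine Finset.sum_congr rfl fun s _ => ?_
  rw [evalFun_prod]

lemma cheb_pair {K : Type*} [Field K] (n : ℕ) : ∃ a b : Polynomial K,
    (a.natDegree = n + 1 ∧ a.Monic ∧ ∀ y : K, y ≠ 0 → a.eval (y + y⁻¹) = y ^ (n + 1) + y⁻¹ ^ (n + 1)) ∧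
    (b.natDegree = n + 2 ∧ b.Monic ∧ ∀ y : K, y ≠ 0 → b.eval (y + y⁻¹) = y ^ (n + 2) + y⁻¹ ^ (n + 2)) := by
  induction n with
  | zero =>
    refine ⟨Polynomial.X, Polynomial.X ^ 2 - Polynomial.C 2, ⟨by simp, Polynomial.monic_X, by simp⟩,
      by rw [Polynomial.natDegree_X_pow_sub_C], Polynomial.monic_X_pow_sub_C _ (by norm_num), ?_⟩
    intro y hy
    simp
    field_simp
    ring
  | succ n ih =>
    obtain ⟨a, b, ⟨a1, a2, a3⟩, ⟨b1, b2, b3⟩⟩ := ih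
    have hX : (Polynomial.X * b).natDegree = n + 3 := by
      rw [Polynomial.natDegree_X_mul b2.ne_zero, b1]
    have hlt : a.degree < (Polynomial.X * b).degree := by
      apply Polynomial.degree_lt_degree
      omega
    refine ⟨b, Polynomial.X * b - a, ⟨b1, b2, b3⟩, ?_, ?_, ?_⟩
    · rw [Polynomial.natDegree_sub_eq_left_of_natDegree_lt (by omega), hX]
    · exact (Polynomial.monic_X.mul b2).sub_of_left hlt
    · intro y hy
      simp only [Polynomial.eval_sub, Polynomial.eval_mul, Polynomial.eval_X, a3 y hy, b3 y hy]
      have hyz : y * y⁻¹ = 1 := mul_inv_cancel₀ hy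
      generalize y⁻¹ = z at hyz
      linear_combination (y ^ (n + 1) + z ^ (n + 1)) * hyz

lemma cheb_exists {K : Type*} [Field K] (n : ℕ) : ∃ q : Polynomial K, q.natDegree = n ∧ q.Monic ∧
    ∀ (N : ℕ), n ≤ N → ∀ y : K, y ≠ 0 → y ^ N * q.eval (y + y⁻¹) =
      ∑ s ∈ ({N - n, N + n} : Finset ℕ), y ^ s := by
  cases n with
  | zero => exact ⟨1, by simp, Polynomial.monic_one, by simp⟩
  | succ n =>
    obtain ⟨a, b, ⟨a1, a2, a3⟩, -⟩ := cheb_pair (K := K) n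
    refine ⟨a, a1, a2, ?_⟩
    intro N hN y hy
    rw [Finset.sum_pair (by omega), a3 y hy, mul_add, add_comm, ← pow_add y N]
    congr 1
    obtain ⟨k, rfl⟩ := Nat.exists_eq_add_of_le hN
    rw [Nat.add_sub_cancel_left, pow_add, mul_right_comm, ← mul_pow, mul_inv_cancel₀ hy, one_pow, one_mul]

lemma colDet_field {K : Type*} [Field K] {n : ℕ} (y : Fin (n + 1) → K) (h0 : ∀ i, y i ≠ 0) :
    colDet (fun j => {n - (j : ℕ), n + (j : ℕ)}) y =
      colDet (fun j => {n - (j : ℕ)}) y * pairProd y := by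
  choose q hq1 hq2 hq3 using fun k : ℕ => cheb_exists (K := K) k
  have h1 : colDet (fun j : Fin (n + 1) => {n - (j : ℕ), n + (j : ℕ)}) y =
      (∏ i, y i ^ n) * (vandermonde (fun i => y i + (y i)⁻¹)).det := by
    rw [det_eval_matrixOfPolynomials_eq_det_vandermonde _ (fun j : Fin (n + 1) => q j)
      (fun j => hq1 j) (fun j => hq2 j), ← det_mul_column, colDet]
    congr 1
    ext i j
    simp only [of_apply]
    rw [hq3 j n (by omega) (y i) (h0 i)]
  have h2 : colDet (fun j : Fin (n + 1) => {n - (j : ℕ)}) y =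
      (∏ i, y i ^ n) * (vandermonde (fun i => (y i)⁻¹)).det := by
    rw [← det_mul_column, colDet]
    congr 1
    ext i j
    simp only [of_apply, Finset.sum_singleton, vandermonde_apply]
    have hj : (j : ℕ) ≤ n := by omega
    rw [inv_pow, pow_sub₀ _ (h0 i) hj]
  rw [h1, h2, mul_assoc]
  congr 1
  rw [det_vandermonde, det_vandermonde, pairProd, ← Finset.prod_mul_distrib]
  refine Finset.prod_congr rfl fun i _ => ?_
  rw [← Finset.prod_mul_distrib]
  refine Finset.prod_congr rfl fun j _ => ?_
  have := h0 i
  have := h0 j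
  field_simp
  ring

lemma colDet_map {B B' : Type*} [CommRing B] [CommRing B'] (f : B →+* B') {m : ℕ}
    (S : Fin m → Finset ℕ) (y : Fin m → B) : colDet S (fun i => f (y i)) = f (colDet S y) := by
  unfold colDet
  rw [RingHom.map_det]
  congr 1
  ext i j
  simp

lemma pairProd_map {B B' : Type*} [CommRing B] [CommRing B'] (f : B →+* B') {m : ℕ}
    (y : Fin m → B) : pairProd (fun i => f (y i)) = f (pairProd y) := by
  simp [pairProd, map_prod]

lemma colDet_poly {R : Type*} [CommRing R] [IsDomain R] {n : ℕ} :
    colDet (fun j => {n - (j : ℕ), n + (j : ℕ)})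
        (MvPolynomial.X : Fin (n + 1) → MvPolynomial (Fin (n + 1)) R) =
      colDet (fun j => {n - (j : ℕ)}) MvPolynomial.X * pairProd MvPolynomial.X := by
  let P := MvPolynomial (Fin (n + 1)) R
  have hinj : Function.Injective (algebraMap P (FractionRing P)) := IsFractionRing.injective _ _
  apply hinj
  rw [map_mul, ← colDet_map, ← colDet_map, ← pairProd_map]
  apply colDet_field
  intro i h
  exact MvPolynomial.X_ne_zero (R := R) i (hinj (by simpa using h))

lemma pairProd_rename {R : Type*} [CommRing R] {m : ℕ} (σ : Equiv.Perm (Fin m)) :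
    MvPolynomial.rename σ (pairProd (MvPolynomial.X : Fin m → MvPolynomial (Fin m) R)) =
      pairProd MvPolynomial.X := by
  have h : ∀ z : Fin m → MvPolynomial (Fin m) R, pairProd z =
      ∏ q ∈ (Finset.univ : Finset (Fin m × Fin m)).filter (fun q => q.1 < q.2),
        (1 - z q.1 * z q.2) := by
    intro z
    unfold pairProd
    rw [Finset.prod_filter, Fintype.prod_prod_type]
    refine Finset.prod_congr rfl fun i _ => ?_
    rw [← Finset.prod_filter]
    refine Finset.prod_congr ?_ fun _ _ => rfl
    ext j; simp
  have h2 := pairProd_map (MvPolynomial.rename (R := R) σ).toRingHom MvPolynomial.X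
  refine h2.symm.trans ?_
  rw [h, h]
  refine Finset.prod_bij'
    (fun q _ => if σ q.1 < σ q.2 then (σ q.1, σ q.2) else (σ q.2, σ q.1))
    (fun q _ => if σ.symm q.1 < σ.symm q.2 then (σ.symm q.1, σ.symm q.2)
      else (σ.symm q.2, σ.symm q.1)) ?_ ?_ ?_ ?_ ?_
  · rintro ⟨i, j⟩ hq
    simp only [Finset.mem_filter, Finset.mem_univ, true_and] at hq ⊢
    have : σ i ≠ σ j := fun e => hq.ne (σ.injective e)
    split_ifs with h1
    · exact h1
    · exact lt_of_le_of_ne (not_lt.1 h1) this.symm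
  · rintro ⟨i, j⟩ hq
    simp only [Finset.mem_filter, Finset.mem_univ, true_and] at hq ⊢
    have : σ.symm i ≠ σ.symm j := fun e => hq.ne (σ.symm.injective e)
    split_ifs with h1
    · exact h1
    · exact lt_of_le_of_ne (not_lt.1 h1) this.symm
  · rintro ⟨i, j⟩ hq
    simp only [Finset.mem_filter, Finset.mem_univ, true_and] at hq
    by_cases h1 : σ i < σ j <;> simp [h1, hq, hq.le, hq.not_gt]
  · rintro ⟨i, j⟩ hq
    simp only [Finset.mem_filter, Finset.mem_univ, true_and] at hq
    by_cases h1 : σ.symm i < σ.symm j <;> simp [h1, hq, hq.le, hq.not_gt]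
  · rintro ⟨i, j⟩ hq
    by_cases h1 : σ i < σ j <;> simp [h1, mul_comm]

/-- the core identity for an abstract sequence -/
lemma core_identity {R : Type*} [CommRing R] [IsDomain R] [CharZero R] {n : ℕ} (c p : ℕ) (hp : p ≤ c)
    (g : ℕ → R) (hg : ∀ a, c + n + 1 ≤ a → g a = 0) :
    (Matrix.of fun i j : Fin (n + 1) => g (hook n p i + (n - j))).det =
      ∑ μ ∈ (monos (c + 1) (n + 1)).filter (fun μ => oc c μ = p),
        (Matrix.of fun i j : Fin (n + 1) => ∑ s ∈ ({n - (j : ℕ), n + (j : ℕ)} : Finset ℕ),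
          g (μ i + i + s)).det := by
  let X : Fin (n + 1) → MvPolynomial (Fin (n + 1)) R := MvPolynomial.X
  let S1 : Fin (n + 1) → Finset ℕ := fun j => {n - (j : ℕ), n + (j : ℕ)}
  let S2 : Fin (n + 1) → Finset ℕ := fun j => {n - (j : ℕ)}
  let A : MvPolynomial (Fin (n + 1)) R := ∑ μ ∈ (monos (c + 1) (n + 1)).filter (fun μ => oc c μ = p), alt X (fun j => μ j + j)
  have hA : ∀ σ : Equiv.Perm (Fin (n + 1)), MvPolynomial.rename σ A =
      ((Equiv.Perm.sign σ : ℤ) : MvPolynomial (Fin (n + 1)) R) * A := by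
    intro σ
    simp only [A]
    rw [map_sum, Finset.mul_sum]
    exact Finset.sum_congr rfl fun μ _ => alt_rename (R := R) (fun j => μ j + j) σ
  have hL : (Matrix.of fun i j : Fin (n + 1) => g (hook n p i + (n - j))).det =
      evalFun g (alt X (hook n p) * colProd S2 X) := by
    rw [← det_eq_evalFun]
    simp [S2]
  have hR : ∑ μ ∈ (monos (c + 1) (n + 1)).filter (fun μ => oc c μ = p),
        (Matrix.of fun i j : Fin (n + 1) => ∑ s ∈ ({n - (j : ℕ), n + (j : ℕ)} : Finset ℕ),
          g (μ i + i + s)).det = evalFun g (A * colProd S1 X) := by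
    simp only [A]
    rw [Finset.sum_mul, map_sum]
    exact Finset.sum_congr rfl fun μ _ => det_eq_evalFun g (fun i => μ i + (i : ℕ)) S1
  have hS : evalFun g (A * colProd S1 X) = evalFun g (A * pairProd X * colProd S2 X) := by
    have hfac : ((n + 1).factorial : R) ≠ 0 := by exact_mod_cast Nat.factorial_ne_zero _
    apply mul_left_cancel₀ hfac
    rw [evalFun_alt g A _ hA, evalFun_alt g (A * pairProd X) _ (fun σ => by
      rw [map_mul, hA, pairProd_rename, mul_assoc]), colProd_alt, colProd_alt, colDet_poly]
    congr 1
    simp only [S2, X]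
    ring
  let I : Ideal (MvPolynomial (Fin (n + 1)) R) := Ideal.span (Set.range fun i : Fin (n + 1) => X i ^ (c + n + 1))
  have hT : A * pairProd X - alt X (hook n p) ∈ I := by
    rw [← Ideal.Quotient.eq_zero_iff_mem, map_sub, sub_eq_zero, map_mul, ← alt_map, ← pairProd_map]
    simp only [A, map_sum, ← alt_map]
    apply littlewood_trunc c p hp
    intro i
    rw [← map_pow, Ideal.Quotient.eq_zero_iff_mem]
    exact Ideal.subset_span ⟨i, rfl⟩
  have hz := evalFun_ideal g hg _ (I.mul_mem_right (colProd S2 X) hT)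
  rw [sub_mul, map_sub, sub_eq_zero] at hz
  rw [hL, hR, hS, hz]

lemma hpoly_map {R R' : Type} [CommRing R] [CommRing R'] (f : R →+* R') {N : ℕ} (x : Fin N → R)
    (m : ℤ) : hpoly (fun i => f (x i)) m = f (hpoly x m) := by
  unfold hpoly
  split_ifs <;> simp [map_sum, map_prod]

lemma schur_map {R R' : Type} [CommRing R] [CommRing R'] (f : R →+* R') {N r : ℕ} (x : Fin N → R)
    (lam : Fin r → ℤ) : schur lam (fun i => f (x i)) = f (schur lam x) := by
  unfold schur
  rw [RingHom.map_det]
  congr 1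
  ext i j
  simp [hpoly_map]

lemma spChar_map {R R' : Type} [CommRing R] [CommRing R'] (f : R →+* R') {N r : ℕ} (x : Fin N → R)
    (lam : Fin r → ℤ) : spChar lam (fun i => f (x i)) = f (spChar lam x) := by
  unfold spChar
  rw [RingHom.map_det]
  congr 1
  ext i j
  simp only [of_apply, RingHom.mapMatrix_apply, map_apply, hpoly_map]
  split_ifs <;> simp

lemma oddCols_eq_oc {n c : ℕ} (μ : Fin n → ℕ) (hμ : ∀ i, μ i ≤ c) :
    oddColsCount c (fun i => c - μ i) = oc c μ := by
  unfold oddColsCount oc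
  rw [Finset.card_filter, Finset.card_filter, ← Finset.sum_range_reflect]
  refine Finset.sum_congr rfl fun j hj => ?_
  rw [Finset.mem_range] at hj
  have : (Finset.univ.filter fun i : Fin n => c - μ i < c - 1 - j + 1) =
      Finset.univ.filter fun i : Fin n => j < μ i := by
    ext i
    have := hμ i
    simp only [Finset.mem_filter, Finset.mem_univ, true_and]
    omega
  rw [this]

lemma main_domain {R : Type} [CommRing R] [IsDomain R] [CharZero R] (n c p : ℕ) (hcp : p ≤ c)
    (N : ℕ) (x : Fin N → R) :
    schur (fun i : Fin (n + 1) => if (i : ℕ) < n + 1 - 1 then (c : ℤ) else (c : ℤ) - (p : ℤ)) x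
      = ∑ ν ∈ ((Fintype.piFinset fun _ : Fin (n + 1) => Finset.range (c + 1)).filter
            (fun ν => Antitone ν ∧ oddColsCount c ν = p)),
          spChar (fun i => (ν i : ℤ)) x := by
  have h := core_identity (n := n) c p hcp (fun a => hpoly x ((c : ℤ) + n - a))
    (fun a ha => by unfold hpoly; rw [if_neg (by omega)])
  have hL : schur (fun i : Fin (n + 1) => if (i : ℕ) < n + 1 - 1 then (c : ℤ) else (c : ℤ) - (p : ℤ)) x
      = (Matrix.of fun i j : Fin (n + 1) =>
        hpoly x ((c : ℤ) + n - ((hook n p i + (n - j) : ℕ) : ℤ))).det := by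
    unfold schur
    congr 1
    ext i j
    simp only [of_apply, hook]
    congr 1
    have hj : (j : ℕ) ≤ n := by omega
    by_cases hi : i = Fin.last n
    · subst hi
      simp [Nat.cast_sub hj]
      ring
    · have : (i : ℕ) < n := Fin.val_lt_last hi
      simp [hi, this, Nat.cast_sub hj]
      ring
  rw [hL, h]
  refine Finset.sum_bij (fun μ _ i => c - μ i) ?_ ?_ ?_ ?_
  · intro μ hμ
    rw [Finset.mem_filter, mem_monos] at hμ
    rw [Finset.mem_filter, Fintype.mem_piFinset]
    refine ⟨fun i => by simp, fun a b hab => ?_, ?_⟩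
    · have := hμ.1.2 hab
      simp only; omega
    · rw [oddCols_eq_oc μ (fun i => by have := hμ.1.1 i; omega), hμ.2]
  · intro a ha b hb hab
    rw [Finset.mem_filter, mem_monos] at ha hb
    funext i
    have h1 : c - a i = c - b i := congrFun hab i
    have h2 := ha.1.1 i
    have h3 := hb.1.1 i
    omega
  · intro ν hν
    rw [Finset.mem_filter, Fintype.mem_piFinset] at hν
    obtain ⟨h1, h2, h3⟩ := hν
    have h1' : ∀ i, ν i ≤ c := fun i => by have := h1 i; rw [Finset.mem_range] at this; omega
    have e : (fun i => c - (c - ν i)) = ν := by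
      funext i; have := h1' i; omega
    refine ⟨fun i => c - ν i, ?_, e⟩
    rw [Finset.mem_filter, mem_monos]
    refine ⟨⟨fun i => by omega, fun a b hab => ?_⟩, ?_⟩
    · have := h2 hab
      simp only; omega
    · rw [← oddCols_eq_oc (fun i => c - ν i) (fun i => by simp), e, h3]
  · intro μ hμ
    rw [Finset.mem_filter, mem_monos] at hμ
    unfold spChar
    congr 1
    ext i j
    have hi : μ i ≤ c := by have := hμ.1.1 i; omega
    have hj : (j : ℕ) ≤ n := by omega
    simp only [of_apply]
    split_ifs with h0
    · rw [h0]
      simp only [Nat.sub_zero, Nat.add_zero, Finset.pair_eq_singleton, Finset.sum_singleton]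
      congr 1
      push_cast [Nat.cast_sub hi]
      ring
    · rw [Finset.sum_pair (by omega)]
      congr 2 <;> push_cast [Nat.cast_sub hi, Nat.cast_sub hj] <;> ring

/-- `s((c^{r-1}, c-p); x) = ∑_{ν ⊆ (c^r), oddcols((c^r)/ν) = p} sp(ν; x)`. -/
theorem schur_eq_sum_spChar
    (r c p : ℕ) (hr : 1 ≤ r) (hcp : p ≤ c)
    (N : ℕ) (R : Type) [CommRing R] (x : Fin N → R) :
    schur (fun i : Fin r => if (i : ℕ) < r - 1 then (c : ℤ) else (c : ℤ) - (p : ℤ)) x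
      = ∑ ν ∈ ((Fintype.piFinset fun _ : Fin r => Finset.range (c + 1)).filter
            (fun ν => Antitone ν ∧ oddColsCount c ν = p)),
          spChar (fun i => (ν i : ℤ)) x := by
  obtain ⟨n, rfl⟩ : ∃ n, r = n + 1 := ⟨r - 1, by omega⟩
  have h := main_domain (R := MvPolynomial (Fin N) ℤ) n c p hcp N MvPolynomial.X
  have h2 := congrArg (MvPolynomial.eval₂Hom (Int.castRingHom R) x) h
  rw [map_sum, ← schur_map] at h2
  simp only [← spChar_map, MvPolynomial.coe_eval₂Hom, MvPolynomial.eval₂_X] at h2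
  exact h2

end
end

section
/- Let N ≥ 1 and let r, c, p be nonnegative integers with 1 ≤ r ≤ N and c ≥ p. If r ≤ ⌈N/2⌉ then s_N((c^{r−1},c−p); x^{±1}) = Σ_{ν ⊆ (c^r), oddcols((c^r)/ν)=p} sp_N(ν; x^{±1}); if r > ⌈N/2⌉ then s_N((c^{r−1},c−p); x^{±1}) = Σ_{ν ⊆ (c^{N−r+1}), oddcols((c^{N−r+1})/ν)=c−p} sp_N(ν; x^{±1}); both are identities of Laurent polynomials in x_1,…,x_n, where N = 2n or N = 2n+1. -/
open scoped Classical
open Finset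

noncomputable section

/-- The `N`-tuple of arguments `x_1, x_1⁻¹, x_2, x_2⁻¹, …` (a trailing `1` if `N` is odd). -/
def xpm {R : Type} [CommRing R] (n N : ℕ) (x : Fin n → Rˣ) : Fin N → R := fun k =>
  if h : (k : ℕ) / 2 < n then
    (if (k : ℕ) % 2 = 0 then ((x ⟨(k : ℕ) / 2, h⟩ : Rˣ) : R)
     else (((x ⟨(k : ℕ) / 2, h⟩)⁻¹ : Rˣ) : R))
  else 1

section AltFunctional
open MvPolynomial
variable {K : Type} [CommRing K]

/-- Alternating linear functionals on polynomials. -/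
def IsAlt {r : ℕ} (L : MvPolynomial (Fin r) K →ₗ[K] K) : Prop :=
  ∀ (i j : Fin r) (f : MvPolynomial (Fin r) K), i ≠ j →
    rename (Equiv.swap i j) f = f → L f = 0

theorem IsAlt.swap {r : ℕ} {L : MvPolynomial (Fin r) K →ₗ[K] K} (hL : IsAlt L)
    {i j : Fin r} (hij : i ≠ j) (f : MvPolynomial (Fin r) K) :
    L (rename (Equiv.swap i j) f) = - L f := by
  have h := hL i j (f + rename (Equiv.swap i j) f) hij (by
    rw [map_add, rename_rename]
    have : (Equiv.swap i j : Fin r → Fin r) ∘ (Equiv.swap i j) = id := by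
      funext k; simp
    rw [this, rename_id_apply, add_comm])
  rw [map_add] at h
  linear_combination h

/-- Monomial with given exponents. -/
def mon {r : ℕ} (g : Fin r → ℕ) : MvPolynomial (Fin r) K := ∏ i, X i ^ g i

theorem rename_mon {r : ℕ} (g : Fin r → ℕ) (s : Equiv.Perm (Fin r)) :
    rename s (mon g : MvPolynomial (Fin r) K) = mon (g ∘ s.symm) := by
  unfold mon
  rw [map_prod]
  refine Fintype.prod_equiv s _ _ (fun i => ?_)
  simp

theorem IsAlt.mon_zero {r : ℕ} {L : MvPolynomial (Fin r) K →ₗ[K] K} (hL : IsAlt L)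
    {i j : Fin r} (hij : i ≠ j) (g : Fin r → ℕ) (h : g i = g j) : L (mon g) = 0 := by
  apply hL i j _ hij
  rw [rename_mon]
  congr 1
  funext k
  simp only [Function.comp, Equiv.symm_swap, Equiv.swap_apply_def]
  split_ifs with h1 h2
  · rw [h1, h]
  · rw [h2, h]
  · rfl

theorem IsAlt.mon_swap {r : ℕ} {L : MvPolynomial (Fin r) K →ₗ[K] K} (hL : IsAlt L)
    {i j : Fin r} (hij : i ≠ j) (g : Fin r → ℕ) :
    L (mon (g ∘ Equiv.swap i j)) = - L (mon g) := by
  rw [← hL.swap hij, rename_mon, Equiv.symm_swap]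

/-- exponents: `e` at 0, `i` for `1 ≤ i ≤ n`, `i+1` for `i > n`. -/
def gex (r e n : ℕ) : Fin (r + 1) → ℕ := fun i =>
  if (i : ℕ) = 0 then e else if (i : ℕ) ≤ n then i else i + 1

theorem IsAlt.gex_rot {r : ℕ} {L : MvPolynomial (Fin (r + 1)) K →ₗ[K] K} (hL : IsAlt L)
    (n : ℕ) (hn : n ≤ r) :
    L (mon (gex r (n + 1) n)) = (-1) ^ n * L (mon (fun i => (i : ℕ) + 1)) := by
  induction n with
  | zero =>
    simp only [pow_zero, one_mul]
    congr 2
    funext i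
    simp only [gex]
    split_ifs <;> omega
  | succ n ih =>
    have h := hL.mon_swap (i := (0 : Fin (r + 1))) (j := ⟨n + 1, by omega⟩)
      (by simp [Fin.ext_iff]) (gex r (n + 1) n)
    rw [ih (by omega)] at h
    rw [pow_succ]
    have h2 : (gex r (n + 1) n) ∘ Equiv.swap (0 : Fin (r + 1)) ⟨n + 1, by omega⟩
        = gex r (n + 1 + 1) (n + 1) := by
      funext k
      simp only [Function.comp, Equiv.swap_apply_def, gex, Fin.ext_iff]
      split_ifs <;> simp_all <;> omega
    rw [h2] at h
    rw [h]; ring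

theorem IsAlt.gex_val {r : ℕ} {L : MvPolynomial (Fin (r + 1)) K →ₗ[K] K} (hL : IsAlt L)
    (n e : ℕ) (hn : n ≤ r) (he : 1 ≤ e) (he' : e ≤ r + 1) :
    L (mon (gex r e n)) = if e = n + 1 then
      (-1) ^ n * L (mon (fun i => (i : ℕ) + 1)) else 0 := by
  split_ifs with h
  · subst h; exact hL.gex_rot n hn
  · rcases Nat.lt_or_gt_of_ne h with h1 | h1
    · refine hL.mon_zero (i := 0) (j := ⟨e, by omega⟩) (by simp [Fin.ext_iff]; omega) _ ?_
      simp only [gex, Fin.val_zero]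
      split_ifs <;> first | rfl | omega
    · refine hL.mon_zero (i := 0) (j := ⟨e - 1, by omega⟩) (by simp [Fin.ext_iff]; omega) _ ?_
      simp only [gex, Fin.val_zero]
      split_ifs <;> first | rfl | omega

/-- factors of the partially expanded product -/
def fac (r m n : ℕ) (j : Fin r) (x y : MvPolynomial (Fin (r + 1)) K) :
    MvPolynomial (Fin (r + 1)) K :=
  y ^ ((j : ℕ) + 1) * (if (j : ℕ) < m then 1 - x * y else if (j : ℕ) < n then 1 else -(x * y))

/-- partially expanded product -/
def part (r m n e : ℕ) : MvPolynomial (Fin (r + 1)) K :=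
  X 0 ^ e * ∏ j : Fin r, fac r m n j (X 0) (X j.succ)

theorem part_step1 (r m e : ℕ) (hm : m < r) :
    (part r (m + 1) (m + 1) e : MvPolynomial (Fin (r + 1)) K)
      = part r m (m + 1) e + part r m m e := by
  unfold part
  rw [← mul_add]
  congr 1
  rw [← Finset.mul_prod_erase univ _ (mem_univ (⟨m, hm⟩ : Fin r)),
    ← Finset.mul_prod_erase univ (fun j : Fin r => fac r m (m + 1) j (X 0) (X j.succ))
      (mem_univ (⟨m, hm⟩ : Fin r)),
    ← Finset.mul_prod_erase univ (fun j : Fin r => fac r m m j (X 0) (X j.succ))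
      (mem_univ (⟨m, hm⟩ : Fin r))]
  have e1 : ∏ j ∈ univ.erase (⟨m, hm⟩ : Fin r),
      (fac r m (m + 1) j (X 0) (X j.succ) : MvPolynomial (Fin (r + 1)) K)
      = ∏ j ∈ univ.erase (⟨m, hm⟩ : Fin r), fac r (m + 1) (m + 1) j (X 0) (X j.succ) := by
    refine Finset.prod_congr rfl (fun j hj => ?_)
    have : (j : ℕ) ≠ m := fun h => (Finset.mem_erase.1 hj).1 (Fin.ext h)
    unfold fac
    congr 1
    split_ifs <;> first | rfl | omega
  have e2 : ∏ j ∈ univ.erase (⟨m, hm⟩ : Fin r),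
      (fac r m m j (X 0) (X j.succ) : MvPolynomial (Fin (r + 1)) K)
      = ∏ j ∈ univ.erase (⟨m, hm⟩ : Fin r), fac r (m + 1) (m + 1) j (X 0) (X j.succ) := by
    refine Finset.prod_congr rfl (fun j hj => ?_)
    have : (j : ℕ) ≠ m := fun h => (Finset.mem_erase.1 hj).1 (Fin.ext h)
    unfold fac
    congr 1
    split_ifs <;> first | rfl | omega
  rw [e1, e2, ← add_mul]
  congr 1
  simp [fac]
  ring

theorem swap_inv {r : ℕ} (a b : Fin r) (F : Fin r → MvPolynomial (Fin (r + 1)) K →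
    MvPolynomial (Fin (r + 1)) K)
    (hF : ∀ j y, rename (Equiv.swap a.succ b.succ) (F j y)
      = F j (rename (Equiv.swap a.succ b.succ) y)) (hab : F a = F b) :
    rename (Equiv.swap a.succ b.succ) (∏ j : Fin r, F j (X j.succ))
      = ∏ j : Fin r, F j (X j.succ) := by
  rw [map_prod]
  refine Fintype.prod_equiv (Equiv.swap a b) _ _ (fun j => ?_)
  rw [hF, rename_X]
  have h1 : Equiv.swap a.succ b.succ j.succ = (Equiv.swap a b j).succ := by
    simp only [Equiv.swap_apply_def, Fin.succ_inj]
    split_ifs <;> rfl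
  rw [h1]
  have h4 : F (Equiv.swap a b j) = F j := by
    simp only [Equiv.swap_apply_def]
    split_ifs with h2 h3
    · rw [h2, hab]
    · rw [h3, hab]
    · rfl
  rw [h4]

theorem IsAlt.part_step2 {r : ℕ} {L : MvPolynomial (Fin (r + 1)) K →ₗ[K] K} (hL : IsAlt L)
    (m n e : ℕ) (hmn : m + 1 < n) (hn : n ≤ r) :
    L (part r (m + 1) n e) = L (part r m n e) := by
  have hm : m < r := by omega
  set a : Fin r := ⟨m, hm⟩ with ha
  set b : Fin r := ⟨m + 1, by omega⟩ with hb
  have hab : a ≠ b := by simp [ha, hb, Fin.ext_iff]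
  let F : Fin r → MvPolynomial (Fin (r + 1)) K → MvPolynomial (Fin (r + 1)) K :=
    fun j y => if j = a then y ^ (m + 2) else fac r m n j (X 0) y
  have key : (part r (m + 1) n e : MvPolynomial (Fin (r + 1)) K)
      = part r m n e + X 0 ^ e * (-(X 0)) * ∏ j : Fin r, F j (X j.succ) := by
    unfold part
    rw [mul_assoc, ← mul_add]
    congr 1
    rw [← Finset.mul_prod_erase univ _ (mem_univ a),
      ← Finset.mul_prod_erase univ (fun j : Fin r => fac r m n j (X 0) (X j.succ))
        (mem_univ a),
      ← Finset.mul_prod_erase univ (fun j : Fin r => F j (X j.succ)) (mem_univ a)]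
    have e1 : ∏ j ∈ univ.erase a,
        (fac r (m + 1) n j (X 0) (X j.succ) : MvPolynomial (Fin (r + 1)) K)
        = ∏ j ∈ univ.erase a, F j (X j.succ) := by
      refine Finset.prod_congr rfl (fun j hj => ?_)
      have h1 := (Finset.mem_erase.1 hj).1
      have : (j : ℕ) ≠ m := fun h => h1 (Fin.ext h)
      simp only [F, h1, if_false, fac]
      congr 1
      split_ifs <;> first | rfl | omega
    have e2 : ∏ j ∈ univ.erase a,
        (fac r m n j (X 0) (X j.succ) : MvPolynomial (Fin (r + 1)) K)
        = ∏ j ∈ univ.erase a, F j (X j.succ) := by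
      refine Finset.prod_congr rfl (fun j hj => ?_)
      have h1 := (Finset.mem_erase.1 hj).1
      simp only [F, h1, if_false]
    rw [e1, e2]
    have : m < n := by omega
    simp [fac, F, ha, this]
    ring
  rw [key, map_add]
  have : L (X 0 ^ e * (-(X 0)) * ∏ j : Fin r, F j (X j.succ)) = 0 := by
    apply hL a.succ b.succ _ (by simpa using hab)
    have h0 : rename (Equiv.swap a.succ b.succ) (X 0 : MvPolynomial (Fin (r + 1)) K) = X 0 := by
      rw [rename_X, Equiv.swap_apply_of_ne_of_ne]
      · exact (Fin.succ_ne_zero _).symm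
      · exact (Fin.succ_ne_zero _).symm
    rw [map_mul, swap_inv]
    · simp [h0]
    · intro j y
      simp only [F, fac]
      split_ifs <;> simp [h0]
    · funext y
      have h1 : ¬ (m + 1 < m) := by omega
      simp only [F, fac, if_true, hab.symm, if_false]
      simp [hb, hmn]
  rw [this, add_zero]

theorem IsAlt.part_low {r : ℕ} {L : MvPolynomial (Fin (r + 1)) K →ₗ[K] K} (hL : IsAlt L)
    (n e : ℕ) (hn : n ≤ r) (m : ℕ) (hmn : m < n) :
    L (part r m n e) = L (part r 0 n e) := by
  induction m with
  | zero => rfl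
  | succ m ih => rw [hL.part_step2 m n e hmn hn, ih (by omega)]

theorem IsAlt.part_sum {r : ℕ} {L : MvPolynomial (Fin (r + 1)) K →ₗ[K] K} (hL : IsAlt L)
    (e m : ℕ) (hm : m ≤ r) :
    L (part r m m e) = ∑ n ∈ range (m + 1), L (part r 0 n e) := by
  induction m with
  | zero => simp
  | succ m ih =>
    rw [part_step1 r m e (by omega), map_add, ih (by omega), Finset.sum_range_succ _ (m + 1),
      hL.part_low (m + 1) e hm m (by omega), add_comm]

theorem part_zero (r n e : ℕ) (hn : n ≤ r) :
    (part r 0 n e : MvPolynomial (Fin (r + 1)) K)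
      = (-1 : K) ^ (r - n) • mon (gex r (e + (r - n)) n) := by
  unfold part mon
  rw [Fin.prod_univ_succ]
  have hcard : ∀ x : MvPolynomial (Fin (r + 1)) K,
      ∏ j : Fin r, (if (j : ℕ) < n then 1 else x) = x ^ (r - n) := by
    intro x
    rw [Fin.prod_univ_eq_prod_range (fun j => if j < n then 1 else x) r]
    obtain ⟨k, rfl⟩ := Nat.exists_eq_add_of_le hn
    rw [Finset.prod_range_add]
    rw [Finset.prod_eq_one (fun j hj => by simp [Finset.mem_range.1 hj])]
    simp
  have : ∏ j : Fin r, (fac r 0 n j (X 0) (X j.succ) : MvPolynomial (Fin (r + 1)) K)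
      = (∏ j : Fin r, (if (j : ℕ) < n then 1 else (-(X 0) : MvPolynomial (Fin (r + 1)) K)))
        * ∏ j : Fin r, X j.succ ^ gex r (e + (r - n)) n j.succ := by
    rw [← Finset.prod_mul_distrib]
    refine Finset.prod_congr rfl (fun j _ => ?_)
    simp only [fac, gex, Fin.val_succ, Nat.not_lt_zero, if_false]
    rw [if_neg (by omega : ¬ ((j : ℕ) + 1 = 0))]
    by_cases h : (j : ℕ) < n
    · rw [if_pos h, if_pos h, if_pos (by omega)]; ring
    · rw [if_neg h, if_neg h, if_neg (by omega)]; ring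
  rw [this, hcard]
  simp only [gex, Fin.val_zero, if_true]
  rw [neg_pow, pow_add, smul_eq_C_mul]
  simp
  ring

theorem IsAlt.one_row {r : ℕ} {L : MvPolynomial (Fin (r + 1)) K →ₗ[K] K} (hL : IsAlt L) (t : K) :
    L (mon (fun i => (i : ℕ)) * ((1 - C t * X 0) * ∏ j : Fin r, (1 - X 0 * X j.succ)))
      = L (mon (fun i => (i : ℕ))) - (if Odd (r + 1) then t else 1) *
        L (mon (fun i => (i : ℕ) + 1)) := by
  have h1 : (mon (fun i : Fin (r + 1) => (i : ℕ)) * ((1 - C t * X 0) *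
      ∏ j : Fin r, (1 - X 0 * X j.succ)) : MvPolynomial (Fin (r + 1)) K)
      = part r r r 0 - t • part r r r 1 := by
    have : ∀ e, (part r r r e : MvPolynomial (Fin (r + 1)) K) =
        X 0 ^ e * (mon (fun i => (i : ℕ)) * ∏ j : Fin r, (1 - X 0 * X j.succ)) := by
      intro e
      unfold part mon
      rw [Fin.prod_univ_succ]
      simp only [Fin.val_zero, pow_zero, one_mul]
      rw [← Finset.prod_mul_distrib]
      congr 1
      refine Finset.prod_congr rfl (fun j _ => ?_)
      simp [fac]
    rw [this, this, smul_eq_C_mul]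
    ring
  have hdl : (gex r 0 r) = fun i : Fin (r + 1) => (i : ℕ) := by
    funext i; simp only [gex]; split_ifs <;> omega
  have h2 : L (part r r r 0) = L (mon (fun i => (i : ℕ))) - (if Odd (r + 1) then 0 else 1) *
        L (mon (fun i => (i : ℕ) + 1)) := by
    rw [hL.part_sum 0 r le_rfl, Finset.sum_range_succ, part_zero r r 0 le_rfl]
    simp only [Nat.sub_self, pow_zero, one_smul, Nat.add_zero, hdl]
    have : ∀ n ∈ range r, L (part r 0 n 0) = if r = 2 * n + 1 then
        - L (mon (fun i => (i : ℕ) + 1)) else 0 := by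
      intro n hn
      have hn := Finset.mem_range.1 hn
      rw [part_zero r n 0 hn.le, map_smul, hL.gex_val n _ hn.le (by omega) (by omega)]
      by_cases h : r = 2 * n + 1
      · rw [if_pos h, if_pos (by omega), smul_eq_mul, ← mul_assoc, ← pow_add,
          show r - n + n = 2 * n + 1 by omega, pow_succ, pow_mul]
        simp
      · rw [if_neg h, if_neg (by omega), smul_zero]
    rw [Finset.sum_congr rfl this]
    by_cases h : Odd (r + 1)
    · rw [if_pos h, Finset.sum_eq_zero]
      · ring
      · intro n _
        rw [if_neg]
        intro h'; subst h'
        rw [Nat.odd_iff] at h; omega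
    · rw [if_neg h]
      obtain ⟨k, hk⟩ : ∃ k, r = 2 * k + 1 := by
        refine ⟨r / 2, ?_⟩
        rw [Nat.odd_iff] at h; omega
      rw [Finset.sum_eq_single k]
      · rw [if_pos hk]; ring
      · intro n _ hn
        rw [if_neg (by omega)]
      · intro h'; exact absurd (Finset.mem_range.2 (by omega)) h'
  have h3 : L (part r r r 1) = (if Odd (r + 1) then 1 else 0) *
        L (mon (fun i => (i : ℕ) + 1)) := by
    rw [hL.part_sum 1 r le_rfl]
    have : ∀ n ∈ range (r + 1), L (part r 0 n 1) = if r = 2 * n then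
        L (mon (fun i => (i : ℕ) + 1)) else 0 := by
      intro n hn
      have hn := Finset.mem_range.1 hn
      rw [part_zero r n 1 (by omega), map_smul, hL.gex_val n _ (by omega) (by omega) (by omega)]
      by_cases h : r = 2 * n
      · rw [if_pos h, if_pos (by omega), smul_eq_mul, ← mul_assoc, ← pow_add,
          show r - n + n = 2 * n by omega, pow_mul]
        simp
      · rw [if_neg h, if_neg (by omega), smul_zero]
    rw [Finset.sum_congr rfl this]
    by_cases h : Odd (r + 1)
    · rw [if_pos h]
      obtain ⟨k, hk⟩ : ∃ k, r = 2 * k := by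
        refine ⟨r / 2, ?_⟩
        rw [Nat.odd_iff] at h; omega
      rw [Finset.sum_eq_single k]
      · rw [if_pos hk]; ring
      · intro n _ hn
        rw [if_neg (by omega)]
      · intro h'; exact absurd (Finset.mem_range.2 (by omega)) h'
    · rw [if_neg h, Finset.sum_eq_zero]
      · ring
      · intro n _
        rw [if_neg]
        intro h'; subst h'
        rw [Nat.odd_iff] at h; omega
  rw [h1, map_sub, map_smul, h2, h3, smul_eq_mul]
  split_ifs <;> ring

end AltFunctional

section MainAlt
open MvPolynomial
variable {K : Type} [CommRing K]

theorem oddColsCount_cons {r : ℕ} (c a : ℕ) (ha : a ≤ c) (ν : Fin r → ℕ) (hν : ∀ i, ν i ≤ a) :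
    oddColsCount c (Fin.cons a ν : Fin (r + 1) → ℕ)
      = (if Odd (r + 1) then c - a else 0) + oddColsCount a ν := by
  obtain ⟨k, rfl⟩ := Nat.exists_eq_add_of_le ha
  unfold oddColsCount
  simp only [Finset.card_filter _ (range _)]
  rw [Finset.sum_range_add, add_comm]
  congr 1
  · have : ∀ x ∈ range k, (if Odd ((univ.filter (fun i : Fin (r + 1) =>
        (Fin.cons a ν : Fin (r + 1) → ℕ) i < a + x + 1)).card) then 1 else 0)
        = if Odd (r + 1) then 1 else 0 := by
      intro x _
      rw [Finset.filter_true_of_mem]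
      · simp
      · intro i _
        refine Fin.cases ?_ (fun j => ?_) i
        · simp
          try omega
        · have := hν j
          simp; omega
    rw [Finset.sum_congr rfl this]
    simp
  · refine Finset.sum_congr rfl (fun x hx => ?_)
    have hx := Finset.mem_range.1 hx
    have : (univ.filter (fun i : Fin (r + 1) =>
        (Fin.cons a ν : Fin (r + 1) → ℕ) i < x + 1)).card
        = (univ.filter (fun i : Fin r => ν i < x + 1)).card := by
      rw [Fin.card_filter_univ_succ]
      simp
      omega
    rw [this]

theorem sum_antitone_succ (r c : ℕ) (F : (Fin (r + 1) → ℕ) → K) :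
    ∑ ν ∈ (Fintype.piFinset fun _ : Fin (r + 1) => range (c + 1)).filter Antitone, F ν
      = ∑ a ∈ range (c + 1), ∑ ν ∈ (Fintype.piFinset fun _ : Fin r => range (a + 1)).filter
          Antitone, F (Fin.cons a ν) := by
  rw [Finset.sum_sigma']
  refine Finset.sum_bij' (fun ν _ => (⟨ν 0, Fin.tail ν⟩ : Σ _ : ℕ, (Fin r → ℕ)))
    (fun p _ => (Fin.cons p.1 p.2 : Fin (r + 1) → ℕ)) ?_ ?_ ?_ ?_ ?_
  · intro ν hν
    simp only [mem_filter, Fintype.mem_piFinset, mem_range] at hν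
    simp only [mem_sigma, mem_filter, Fintype.mem_piFinset, mem_range]
    refine ⟨hν.1 0, fun i => ?_, fun i j hij => ?_⟩
    · have := hν.2 (Fin.zero_le i.succ)
      simp only [Fin.tail]; omega
    · exact hν.2 (Fin.succ_le_succ_iff.2 hij)
  · rintro ⟨a, ν⟩ h
    simp only [mem_sigma, mem_filter, Fintype.mem_piFinset, mem_range] at h
    simp only [mem_filter, Fintype.mem_piFinset, mem_range]
    obtain ⟨h1, h2, h3⟩ := h
    refine ⟨fun i => ?_, ?_⟩
    · refine Fin.cases ?_ (fun j => ?_) i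
      · simpa using h1
      · have := h2 j
        simp; omega
    · intro i j
      refine Fin.cases ?_ (fun i' => ?_) i
      · refine Fin.cases ?_ (fun j' => ?_) j
        · intro _; exact le_rfl
        · intro _; have := h2 j'
          simp; omega
      · refine Fin.cases ?_ (fun j' => ?_) j
        · intro h; simp at h
        · intro h
          simpa using h3 (Fin.succ_le_succ_iff.1 h)
  · intro ν _
    simp
  · rintro ⟨a, ν⟩ _
    simp
  · intro ν _
    simp

/-- The product `∏ (1 - t w_i) ∏_{i<j} (1 - w_i w_j)`. -/
def GT (t : K) (r : ℕ) : MvPolynomial (Fin r) K :=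
  ∏ i, ((1 - C t * X i) * ∏ j ∈ Ioi i, (1 - X i * X j))

theorem GT_succ (t : K) (r : ℕ) : GT t (r + 1)
    = ((1 - C t * X 0) * ∏ j : Fin r, (1 - X 0 * X j.succ)) * rename Fin.succ (GT t r) := by
  unfold GT
  rw [Fin.prod_univ_succ, Fin.prod_Ioi_zero
    (fun j => (1 - X 0 * X j : MvPolynomial (Fin (r + 1)) K)), map_prod]
  congr 1
  refine Finset.prod_congr rfl (fun i _ => ?_)
  rw [Fin.prod_Ioi_succ
    (fun j => (1 - X i.succ * X j : MvPolynomial (Fin (r + 1)) K)) i]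
  simp [map_prod]

theorem mon_mul {r : ℕ} (g g' : Fin r → ℕ) :
    (mon g * mon g' : MvPolynomial (Fin r) K) = mon (fun i => g i + g' i) := by
  unfold mon
  rw [← Finset.prod_mul_distrib]
  simp only [pow_add]

theorem rename_succ_mon {r : ℕ} (g : Fin r → ℕ) :
    rename Fin.succ (mon g : MvPolynomial (Fin r) K) = mon (Fin.cons 0 g : Fin (r + 1) → ℕ) := by
  unfold mon
  rw [Fin.prod_univ_succ]
  simp

set_option maxHeartbeats 1000000 in
theorem main_alt (t : K) (r : ℕ) : ∀ (c : ℕ) (L : MvPolynomial (Fin r) K →ₗ[K] K), IsAlt L →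
    (∀ (i : Fin r) (f : MvPolynomial (Fin r) K), L (X i ^ (c + r) * f) = 0) →
    ∑ ν ∈ (Fintype.piFinset fun _ : Fin r => range (c + 1)).filter Antitone,
      t ^ oddColsCount c ν * L (mon (fun i => c - ν i + i) * GT t r)
    = L (mon (fun i => (i : ℕ))) := by
  induction r with
  | zero =>
    intro c L _ _
    have h : ((Fintype.piFinset fun _ : Fin 0 => range (c + 1)).filter Antitone)
        = {Fin.elim0} := by
      ext ν
      simp only [mem_filter, Fintype.mem_piFinset, mem_singleton]
      constructor
      · intro _; exact Subsingleton.elim _ _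
      · intro _; exact ⟨fun i => i.elim0, fun i => i.elim0⟩
    rw [h, Finset.sum_singleton]
    simp [oddColsCount, mon, GT]
  | succ r ih =>
    intro c L hL hB
    rw [sum_antitone_succ]
    set s : K := if Odd (r + 1) then t else 1 with hs
    have step : ∀ a ∈ range (c + 1),
        ∑ ν ∈ (Fintype.piFinset fun _ : Fin r => range (a + 1)).filter Antitone,
          t ^ oddColsCount c (Fin.cons a ν : Fin (r + 1) → ℕ)
            * L (mon (fun i => c - (Fin.cons a ν : Fin (r + 1) → ℕ) i + i) * GT t (r + 1))
        = s ^ (c - a) * L (mon (fun i => (i : ℕ) + (c - a)))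
          - s ^ (c - a + 1) * L (mon (fun i => (i : ℕ) + (c - a + 1))) := by
      intro a ha
      have ha : a ≤ c := by have := Finset.mem_range.1 ha; omega
      let M : MvPolynomial (Fin (r + 1)) K :=
        mon (Fin.cons (c - a) (fun _ => c - a + 1) : Fin (r + 1) → ℕ) *
          ((1 - C t * X 0) * ∏ j : Fin r, (1 - X 0 * X j.succ))
      let L' : MvPolynomial (Fin r) K →ₗ[K] K :=
        (L ∘ₗ LinearMap.mulLeft K M) ∘ₗ (rename Fin.succ).toLinearMap
      have hL'def : ∀ f, L' f = L (M * rename Fin.succ f) := fun f => rfl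
      have hL' : IsAlt L' := by
        intro i j f hij hf
        rw [hL'def]
        apply hL i.succ j.succ _ (by simpa using hij)
        have hcomp : (Equiv.swap i.succ j.succ : Fin (r + 1) → Fin (r + 1)) ∘ Fin.succ
            = Fin.succ ∘ (Equiv.swap i j) := by
          funext k
          simp only [Function.comp, Equiv.swap_apply_def, Fin.succ_inj]
          split_ifs <;> rfl
        have h0 : rename (Equiv.swap i.succ j.succ) (X 0 : MvPolynomial (Fin (r + 1)) K)
            = X 0 := by
          rw [rename_X, Equiv.swap_apply_of_ne_of_ne]
          · exact (Fin.succ_ne_zero _).symm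
          · exact (Fin.succ_ne_zero _).symm
        rw [map_mul, rename_rename, hcomp, ← rename_rename, hf]
        congr 1
        simp only [M]
        rw [map_mul, map_mul, swap_inv i j (fun _ y => 1 - X 0 * y) (by intro _ y; simp [h0]) rfl,
          rename_mon]
        congr 2
        · funext k
          rw [Function.comp_apply, Equiv.symm_swap]
          refine Fin.cases ?_ (fun k' => ?_) k
          · rw [Equiv.swap_apply_of_ne_of_ne (Fin.succ_ne_zero _).symm (Fin.succ_ne_zero _).symm]
          · have := congrFun hcomp k'
            simp only [Function.comp] at this
            rw [this, Fin.cons_succ, Fin.cons_succ]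
        · simp [h0]
      have hB' : ∀ (i : Fin r) (f : MvPolynomial (Fin r) K), L' (X i ^ (a + r) * f) = 0 := by
        intro i f
        rw [hL'def, map_mul (rename Fin.succ), map_pow, rename_X]
        simp only [M, mon]
        rw [Fin.prod_univ_succ, ← Finset.mul_prod_erase univ _ (mem_univ i)]
        simp only [Fin.cons_zero, Fin.cons_succ]
        have := hB i.succ (X 0 ^ (c - a) * (∏ x ∈ univ.erase i, X x.succ ^ (c - a + 1)) *
          ((1 - C t * X 0) * ∏ j : Fin r, (1 - X 0 * X j.succ)) * rename Fin.succ f)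
        rw [show c + (r + 1) = (c - a + 1) + (a + r) by omega, pow_add] at this
        rw [← this]
        refine congrArg L ?_
        generalize (∏ x ∈ univ.erase i, (X x.succ : MvPolynomial (Fin (r + 1)) K) ^ (c - a + 1)) = u1
        generalize (∏ j : Fin r, (1 - X 0 * X j.succ : MvPolynomial (Fin (r + 1)) K)) = u2
        generalize (X i.succ : MvPolynomial (Fin (r + 1)) K) ^ (c - a + 1) = u3
        generalize (X i.succ : MvPolynomial (Fin (r + 1)) K) ^ (a + r) = u4
        generalize (X 0 : MvPolynomial (Fin (r + 1)) K) ^ (c - a) = u5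
        generalize (1 - C t * X 0 : MvPolynomial (Fin (r + 1)) K) = u6
        ring
      have h1 := ih a L' hL' hB'
      have h2 : ∀ ν ∈ (Fintype.piFinset fun _ : Fin r => range (a + 1)).filter Antitone,
          t ^ oddColsCount c (Fin.cons a ν : Fin (r + 1) → ℕ)
            * L (mon (fun i => c - (Fin.cons a ν : Fin (r + 1) → ℕ) i + i) * GT t (r + 1))
          = s ^ (c - a) * (t ^ oddColsCount a ν * L' (mon (fun i => a - ν i + i) * GT t r)) := by
        intro ν hν
        simp only [mem_filter, Fintype.mem_piFinset, mem_range] at hν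
        have hνa : ∀ i, ν i ≤ a := fun i => by have := hν.1 i; omega
        rw [oddColsCount_cons c a ha ν hνa, hL'def, pow_add, ← mul_assoc (s ^ (c - a))]
        congr 1
        · congr 1
          rw [hs]
          split_ifs <;> simp
        · congr 1
          rw [GT_succ, map_mul, rename_succ_mon]
          simp only [M]
          have hm : (mon (fun i => c - (Fin.cons a ν : Fin (r + 1) → ℕ) i + i) :
              MvPolynomial (Fin (r + 1)) K)
              = mon (Fin.cons (c - a) (fun _ => c - a + 1) : Fin (r + 1) → ℕ) *
                mon (Fin.cons 0 (fun i => a - ν i + i) : Fin (r + 1) → ℕ) := by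
            rw [mon_mul]
            congr 1
            funext i
            refine Fin.cases ?_ (fun j => ?_) i
            · simp
            · have := hνa j
              simp
              omega
          rw [hm]; ring
      rw [Finset.sum_congr rfl h2, ← Finset.mul_sum, h1, hL'def, rename_succ_mon]
      have h3 : L (M * mon (Fin.cons 0 (fun i : Fin r => (i : ℕ)) : Fin (r + 1) → ℕ))
          = (L ∘ₗ LinearMap.mulLeft K (mon (fun _ => c - a)))
              (mon (fun i => (i : ℕ)) * ((1 - C t * X 0) * ∏ j : Fin r, (1 - X 0 * X j.succ))) := by
        simp only [LinearMap.comp_apply, LinearMap.mulLeft_apply, M]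
        rw [mul_right_comm, mon_mul, ← mul_assoc (mon _) (mon _), mon_mul]
        congr 3
        funext i
        refine Fin.cases ?_ (fun j => ?_) i
        · simp
        · simp; omega
      have hL'' : IsAlt (L ∘ₗ LinearMap.mulLeft K (mon (fun _ => c - a))) := by
        intro i j f hij hf
        simp only [LinearMap.comp_apply, LinearMap.mulLeft_apply]
        apply hL i j _ hij
        rw [map_mul, hf, rename_mon]
        rfl
      rw [h3, hL''.one_row t]
      simp only [LinearMap.comp_apply, LinearMap.mulLeft_apply, mon_mul]
      rw [← hs]
      have e1 : (fun i : Fin (r + 1) => c - a + (i : ℕ)) = fun i : Fin (r + 1) => (i : ℕ) + (c - a) := by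
        funext i; omega
      have e2 : (fun i : Fin (r + 1) => c - a + ((i : ℕ) + 1))
          = fun i : Fin (r + 1) => (i : ℕ) + (c - a + 1) := by
        funext i; omega
      rw [e1, e2, pow_succ]
      ring
    rw [Finset.sum_congr rfl step]
    rw [← Finset.sum_range_reflect]
    have h5 : ∀ j ∈ range (c + 1),
        (s ^ (c - (c + 1 - 1 - j)) * L (mon (fun i => (i : ℕ) + (c - (c + 1 - 1 - j))))
          - s ^ (c - (c + 1 - 1 - j) + 1) *
            L (mon (fun i => (i : ℕ) + (c - (c + 1 - 1 - j) + 1))))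
        = (fun m => s ^ m * L (mon (fun i => (i : ℕ) + m))) j
          - (fun m => s ^ m * L (mon (fun i => (i : ℕ) + m))) (j + 1) := by
      intro j hj
      have hj := Finset.mem_range.1 hj
      rw [show c - (c + 1 - 1 - j) = j by omega]
    rw [Finset.sum_congr rfl h5, Finset.sum_range_sub']
    have h6 : L (mon (fun i => (i : ℕ) + (c + 1))) = 0 := by
      unfold mon
      rw [← Finset.mul_prod_erase univ _ (mem_univ (Fin.last r))]
      convert hB (Fin.last r) _ using 3
      simp; ring
    simp only [h6]
    simp

end MainAlt

section Weyl
open Polynomial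

/-- The polynomials `1, D_1, D_2, ...` (Dickson polynomials of parameter one). -/
def dk (n : ℕ) : ℤ[X] := if n = 0 then 1 else dickson 1 1 n

theorem dickson_monic : ∀ n : ℕ, (dickson 1 (1 : ℤ) (n + 1)).Monic ∧
    (dickson 1 (1 : ℤ) (n + 1)).natDegree = n + 1
  | 0 => by simp [dickson_one, monic_X]
  | 1 => by
      have h : dickson 1 (1 : ℤ) (1 + 1) = X ^ 2 - C 2 := by
        rw [show 1 + 1 = 0 + 2 from rfl, dickson_add_two]
        simp [dickson_one, dickson_zero]
        ring
      rw [h]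
      exact ⟨monic_X_pow_sub_C _ (by norm_num), natDegree_X_pow_sub_C⟩
  | n + 2 => by
      obtain ⟨h1, d1⟩ := dickson_monic (n + 1)
      obtain ⟨h0, d0⟩ := dickson_monic n
      have h : dickson 1 (1 : ℤ) (n + 2 + 1)
          = X * dickson 1 1 (n + 1 + 1) - dickson 1 1 (n + 1) := by
        rw [show n + 2 + 1 = (n + 1) + 2 from rfl, dickson_add_two]
        simp
      have hm : (X * dickson 1 (1 : ℤ) (n + 1 + 1)).Monic := monic_X.mul h1
      have hd : (X * dickson 1 (1 : ℤ) (n + 1 + 1)).natDegree = n + 3 := by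
        rw [monic_X.natDegree_mul h1, d1, natDegree_X]; omega
      have hlt : (dickson 1 (1 : ℤ) (n + 1)).degree
          < (X * dickson 1 (1 : ℤ) (n + 1 + 1)).degree := by
        apply degree_lt_degree
        rw [hd, d0]; omega
      rw [h]
      refine ⟨hm.sub_of_left hlt, ?_⟩
      rw [natDegree_sub_eq_left_of_natDegree_lt (by rw [hd, d0]; omega), hd]

theorem dk_monic (n : ℕ) : (dk n).Monic := by
  unfold dk
  split_ifs with h
  · exact monic_one
  · obtain ⟨m, rfl⟩ := Nat.exists_eq_succ_of_ne_zero h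
    exact (dickson_monic m).1

theorem dk_natDegree (n : ℕ) : (dk n).natDegree = n := by
  unfold dk
  split_ifs with h
  · simp [h]
  · obtain ⟨m, rfl⟩ := Nat.exists_eq_succ_of_ne_zero h
    exact (dickson_monic m).2

theorem weyl_field {F : Type} [Field F] {r : ℕ} (w : Fin r → F) (hw : ∀ i, w i ≠ 0) :
    Matrix.det (Matrix.of fun i j : Fin r =>
      if (j : ℕ) = 0 then w i ^ (r - 1) else w i ^ (r - 1 - j) + w i ^ (r - 1 + j))
    = Matrix.det (Matrix.of fun i j : Fin r => w i ^ (r - 1 - j)) *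
      ∏ i, ∏ j ∈ Ioi i, (1 - w i * w j) := by
  have e1 : (Matrix.of fun i j : Fin r =>
      if (j : ℕ) = 0 then w i ^ (r - 1) else w i ^ (r - 1 - j) + w i ^ (r - 1 + j))
      = Matrix.of fun i j : Fin r => w i ^ (r - 1) *
        (Matrix.of fun i j : Fin r => ((dk j).map (Int.castRingHom F)).eval (w i + (w i)⁻¹)) i j := by
    ext i j
    simp only [Matrix.of_apply, dk]
    split_ifs with h
    · simp
    · rw [map_dickson]
      simp only [map_one]
      rw [dickson_one_one_eval_add_inv _ _ (mul_inv_cancel₀ (hw i)), mul_add, add_comm, pow_add]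
      congr 1
      have hj := j.2
      have : w i ^ (r - 1) = w i ^ (r - 1 - j) * w i ^ (j : ℕ) := by
        rw [← pow_add]; congr 1; omega
      rw [this, mul_assoc, ← mul_pow, mul_inv_cancel₀ (hw i), one_pow, mul_one]
  have e2 : (Matrix.of fun i j : Fin r => w i ^ (r - 1 - j))
      = Matrix.of fun i j : Fin r => w i ^ (r - 1) *
        (Matrix.vandermonde fun i => (w i)⁻¹) i j := by
    ext i j
    simp only [Matrix.of_apply, Matrix.vandermonde_apply]
    have hj := j.2
    have : w i ^ (r - 1) = w i ^ (r - 1 - j) * w i ^ (j : ℕ) := by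
      rw [← pow_add]; congr 1; omega
    rw [this, mul_assoc, ← mul_pow, mul_inv_cancel₀ (hw i), one_pow, mul_one]
  rw [e1, e2, Matrix.det_mul_column, Matrix.det_mul_column, Matrix.det_vandermonde,
    ← Matrix.det_eval_matrixOfPolynomials_eq_det_vandermonde (fun i => w i + (w i)⁻¹)
      (fun j : Fin r => (dk j).map (Int.castRingHom F)), Matrix.det_vandermonde]
  · rw [mul_assoc]
    congr 1
    rw [← Finset.prod_mul_distrib]
    refine Finset.prod_congr rfl fun i _ => ?_
    rw [← Finset.prod_mul_distrib]
    refine Finset.prod_congr rfl fun j _ => ?_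
    have := hw i
    have := hw j
    field_simp
    ring
  · intro i
    rw [(dk_monic i).natDegree_map, dk_natDegree]
  · intro i
    exact (dk_monic i).map _

end Weyl

section Weyl2
open MvPolynomial

theorem weyl_int (r : ℕ) :
    Matrix.det (Matrix.of fun i j : Fin r =>
      if (j : ℕ) = 0 then (X i : MvPolynomial (Fin r) ℤ) ^ (r - 1)
        else X i ^ (r - 1 - j) + X i ^ (r - 1 + j))
    = Matrix.det (Matrix.of fun i j : Fin r => (X i : MvPolynomial (Fin r) ℤ) ^ (r - 1 - j)) *
      ∏ i, ∏ j ∈ Ioi i, (1 - X i * X j) := by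
  let F := FractionRing (MvPolynomial (Fin r) ℤ)
  let φ : MvPolynomial (Fin r) ℤ →+* F := algebraMap _ _
  have hφ : Function.Injective φ := IsFractionRing.injective _ _
  apply hφ
  have h := weyl_field (fun i : Fin r => φ (X i)) (fun i => by
    rw [Ne, map_eq_zero_iff φ hφ]; exact X_ne_zero i)
  have e1 : φ.mapMatrix (Matrix.of fun i j : Fin r =>
      if (j : ℕ) = 0 then (X i : MvPolynomial (Fin r) ℤ) ^ (r - 1)
        else X i ^ (r - 1 - j) + X i ^ (r - 1 + j))
      = Matrix.of fun i j : Fin r => if (j : ℕ) = 0 then φ (X i) ^ (r - 1)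
        else φ (X i) ^ (r - 1 - j) + φ (X i) ^ (r - 1 + j) := by
    refine Matrix.ext fun i j => ?_
    simp only [RingHom.mapMatrix_apply, Matrix.map_apply, Matrix.of_apply]
    split_ifs <;> simp
  have e2 : φ.mapMatrix (Matrix.of fun i j : Fin r =>
      (X i : MvPolynomial (Fin r) ℤ) ^ (r - 1 - j))
      = Matrix.of fun i j : Fin r => φ (X i) ^ (r - 1 - j) := by
    refine Matrix.ext fun i j => ?_
    simp
  rw [map_mul, RingHom.map_det, RingHom.map_det, e1, e2, h]
  simp only [map_prod, map_sub, map_mul, map_one]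

theorem weyl_mv {K : Type} [CommRing K] (r : ℕ) :
    Matrix.det (Matrix.of fun i j : Fin r =>
      if (j : ℕ) = 0 then (X i : MvPolynomial (Fin r) K) ^ (r - 1)
        else X i ^ (r - 1 - j) + X i ^ (r - 1 + j))
    = Matrix.det (Matrix.of fun i j : Fin r => (X i : MvPolynomial (Fin r) K) ^ (r - 1 - j)) *
      ∏ i, ∏ j ∈ Ioi i, (1 - X i * X j) := by
  let φ : MvPolynomial (Fin r) ℤ →+* MvPolynomial (Fin r) K := MvPolynomial.map (Int.castRingHom K)
  have hX : ∀ i, φ (X i) = X i := fun i => MvPolynomial.map_X _ _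
  have h := congrArg φ (weyl_int r)
  have e1 : φ.mapMatrix (Matrix.of fun i j : Fin r =>
      if (j : ℕ) = 0 then (X i : MvPolynomial (Fin r) ℤ) ^ (r - 1)
        else X i ^ (r - 1 - j) + X i ^ (r - 1 + j))
      = Matrix.of fun i j : Fin r => if (j : ℕ) = 0 then X i ^ (r - 1)
        else X i ^ (r - 1 - j) + X i ^ (r - 1 + j) := by
    refine Matrix.ext fun i j => ?_
    simp only [RingHom.mapMatrix_apply, Matrix.map_apply, Matrix.of_apply]
    split_ifs <;> simp [hX]
  have e2 : φ.mapMatrix (Matrix.of fun i j : Fin r =>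
      (X i : MvPolynomial (Fin r) ℤ) ^ (r - 1 - j))
      = Matrix.of fun i j : Fin r => X i ^ (r - 1 - j) := by
    refine Matrix.ext fun i j => ?_
    simp [hX]
  rw [map_mul, RingHom.map_det, RingHom.map_det, e1, e2] at h
  rw [h]
  simp only [map_prod, map_sub, map_mul, map_one, hX]

end Weyl2

section Func
variable {K : Type} [CommRing K]

/-- The functional `X^k ↦ G (s-k)`. -/
def lfun (G : ℤ → K) (s : ℤ) : Polynomial K →ₗ[K] K :=
  (Polynomial.basisMonomials K).constr K (fun k => G (s - k))

theorem lfun_monomial (G : ℤ → K) (s : ℤ) (k : ℕ) (a : K) :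
    lfun G s (Polynomial.monomial k a) = a * G (s - k) := by
  have h : Polynomial.monomial k a = a • (Polynomial.basisMonomials K) k := by
    simp [Polynomial.smul_monomial]
  rw [h, map_smul, lfun, Module.Basis.constr_basis, smul_eq_mul]

theorem lfun_X_pow (G : ℤ → K) (s : ℤ) (k : ℕ) :
    lfun G s (Polynomial.X ^ k) = G (s - k) := by
  rw [Polynomial.X_pow_eq_monomial, lfun_monomial, one_mul]

open MvPolynomial

/-- The functional `w^α ↦ ∏ G (s - α_i)`. -/
def Lfun {r : ℕ} (G : ℤ → K) (s : ℤ) : MvPolynomial (Fin r) K →ₗ[K] K :=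
  (MvPolynomial.basisMonomials (Fin r) K).constr K (fun α => ∏ i, G (s - (α i : ℕ)))

theorem Lfun_monomial {r : ℕ} (G : ℤ → K) (s : ℤ) (α : Fin r →₀ ℕ) (a : K) :
    Lfun G s (monomial α a) = a * ∏ i, G (s - (α i : ℕ)) := by
  have h : monomial α a = a • (MvPolynomial.basisMonomials (Fin r) K) α := by
    simp [MvPolynomial.smul_monomial]
  rw [h, map_smul, Lfun, Module.Basis.constr_basis, smul_eq_mul]

theorem Lfun_mon {r : ℕ} (G : ℤ → K) (s : ℤ) (g : Fin r → ℕ) :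
    Lfun G s (mon g) = ∏ i, G (s - (g i : ℕ)) := by
  have h : (mon g : MvPolynomial (Fin r) K) = monomial (Finsupp.equivFunOnFinite.symm g) 1 := by
    rw [monomial_eq, Finsupp.prod_fintype _ _ (by simp)]
    simp [mon]
  rw [h, Lfun_monomial, one_mul]
  rfl

theorem Lfun_prod {r : ℕ} (G : ℤ → K) (s : ℤ) (p : Fin r → Polynomial K) :
    Lfun G s (∏ i, Polynomial.aeval (X i : MvPolynomial (Fin r) K) (p i))
      = ∏ i, lfun G s (p i) := by
  have h1 : ∀ i, Polynomial.aeval (X i : MvPolynomial (Fin r) K) (p i)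
      = ∑ k ∈ (p i).support, C ((p i).coeff k) * X i ^ k := by
    intro i
    rw [Polynomial.aeval_def, Polynomial.eval₂_eq_sum, Polynomial.sum_def]
    rfl
  have h2 : ∀ i, lfun G s (p i) = ∑ k ∈ (p i).support, (p i).coeff k * G (s - (k : ℕ)) := by
    intro i
    conv_lhs => rw [(p i).as_sum_support, map_sum]
    simp only [lfun_monomial]
  simp only [h1, h2, Finset.prod_univ_sum, map_sum]
  refine Finset.sum_congr rfl fun g _ => ?_
  rw [Finset.prod_mul_distrib, Finset.prod_mul_distrib, ← map_prod, ← smul_eq_C_mul, map_smul,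
    smul_eq_mul]
  congr 1
  exact Lfun_mon G s g

theorem Lfun_det {r : ℕ} (G : ℤ → K) (s : ℤ) (u q : Fin r → Polynomial K) :
    Lfun G s ((∏ i, Polynomial.aeval (X i : MvPolynomial (Fin r) K) (u i)) *
      Matrix.det (Matrix.of fun i j : Fin r =>
        Polynomial.aeval (X i : MvPolynomial (Fin r) K) (q j)))
      = Matrix.det (Matrix.of fun i j : Fin r => lfun G s (u i * q j)) := by
  rw [← Matrix.det_transpose, ← Matrix.det_transpose (Matrix.of fun i j : Fin r => lfun G s (u i * q j)),
    Matrix.det_apply, Matrix.det_apply, Finset.mul_sum, map_sum]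
  refine Finset.sum_congr rfl fun σ _ => ?_
  rw [mul_smul_comm, Units.smul_def, Units.smul_def, map_zsmul]
  congr 1
  simp only [Matrix.transpose_apply, Matrix.of_apply]
  rw [← Finset.prod_mul_distrib]
  simp only [← map_mul]
  exact Lfun_prod G s _

theorem Lfun_rename {r : ℕ} (G : ℤ → K) (s : ℤ) (σ : Equiv.Perm (Fin r))
    (f : MvPolynomial (Fin r) K) : Lfun G s (rename σ f) = Lfun G s f := by
  induction f using MvPolynomial.induction_on' with
  | monomial α a =>
    rw [rename_monomial, Lfun_monomial, Lfun_monomial]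
    congr 1
    refine (Fintype.prod_equiv σ _ _ fun i => ?_).symm
    rw [Finsupp.mapDomain_apply σ.injective]
  | add f g hf hg => rw [map_add, map_add, map_add, hf, hg]

/-- The alternating functional. -/
def Afun {r : ℕ} (G : ℤ → K) (s : ℤ) : MvPolynomial (Fin r) K →ₗ[K] K :=
  Lfun G s ∘ₗ LinearMap.mulRight K
    (Matrix.det (Matrix.of fun i j : Fin r => (X i : MvPolynomial (Fin r) K) ^ (r - 1 - j)))

theorem Afun_apply {r : ℕ} (G : ℤ → K) (s : ℤ) (f : MvPolynomial (Fin r) K) :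
    Afun G s f = Lfun G s (f * Matrix.det (Matrix.of fun i j : Fin r =>
      (X i : MvPolynomial (Fin r) K) ^ (r - 1 - j))) := rfl

theorem Afun_isAlt {r : ℕ} (G : ℤ → K) (s : ℤ) : IsAlt (Afun (r := r) G s) := by
  intro i j f hij hf
  rw [Afun_apply, Matrix.det_apply, Finset.mul_sum, map_sum]
  refine Finset.sum_involution (fun σ _ => Equiv.swap i j * σ) ?_ ?_ ?_ ?_
  · intro σ _
    rw [mul_smul_comm, mul_smul_comm, Units.smul_def, Units.smul_def, map_zsmul, map_zsmul,
      Equiv.Perm.sign_mul, Equiv.Perm.sign_swap hij]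
    have : Lfun G s (f * ∏ k, (Matrix.of fun i j : Fin r =>
        (X i : MvPolynomial (Fin r) K) ^ (r - 1 - j)) ((Equiv.swap i j * σ) k) k)
        = Lfun G s (f * ∏ k, (Matrix.of fun i j : Fin r =>
        (X i : MvPolynomial (Fin r) K) ^ (r - 1 - j)) (σ k) k) := by
      rw [← Lfun_rename G s (Equiv.swap i j) (f * ∏ k, (Matrix.of fun i j : Fin r =>
        (X i : MvPolynomial (Fin r) K) ^ (r - 1 - j)) (σ k) k), map_mul (rename _), hf, map_prod]
      simp
    rw [this]
    simp
  · intro σ _ _ h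
    have := congrArg (fun τ => (τ * σ⁻¹) i) h
    simp at this
    exact hij this.symm
  · intro σ _; exact mem_univ _
  · intro σ _
    simp [← mul_assoc]

theorem Afun_bound {r : ℕ} (G : ℤ → K) (hG : ∀ m < 0, G m = 0) (c : ℕ) (i : Fin r)
    (f : MvPolynomial (Fin r) K) : Afun G (c + r - 1) (X i ^ (c + r) * f) = 0 := by
  rw [Afun_apply, mul_assoc]
  generalize f * _ = g
  induction g using MvPolynomial.induction_on' with
  | monomial α a =>
    rw [X_pow_eq_monomial, monomial_mul, Lfun_monomial,
      Finset.prod_eq_zero (mem_univ i), mul_zero]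
    apply hG
    simp
  | add f g hf hg => rw [mul_add, map_add, hf, hg, add_zero]

theorem Afun_delta {r : ℕ} (G : ℤ → K) (c : ℕ) :
    Afun G (c + r - 1) (mon (fun i : Fin r => (i : ℕ)))
      = Matrix.det (Matrix.of fun i j : Fin r => G ((c : ℤ) - ((i : ℕ) : ℤ) + ((j : ℕ) : ℤ))) := by
  have h := Lfun_det (r := r) G (c + r - 1) (fun i => Polynomial.X ^ (i : ℕ))
    (fun j => Polynomial.X ^ (r - 1 - (j : ℕ)))
  simp only [map_pow, Polynomial.aeval_X, ← pow_add, lfun_X_pow] at h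
  rw [Afun_apply]
  refine h.trans ?_
  congr 1
  ext i j
  simp only [Matrix.of_apply]
  congr 1
  have := j.2
  omega

theorem Afun_sp {r : ℕ} (t : K) (G : ℤ → K) (c : ℕ) (ν : Fin r → ℕ) (hν : ∀ i, ν i ≤ c) :
    Afun G (c + r - 1) (mon (fun i : Fin r => c - ν i + i) * GT t r)
      = Matrix.det (Matrix.of fun i j : Fin r =>
        if (j : ℕ) = 0 then
          (G ((ν i : ℤ) - ((i : ℕ) : ℤ)) - t * G ((ν i : ℤ) - ((i : ℕ) : ℤ) - 1))
        else (G ((ν i : ℤ) - ((i : ℕ) : ℤ) + ((j : ℕ) : ℤ))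
            - t * G ((ν i : ℤ) - ((i : ℕ) : ℤ) + ((j : ℕ) : ℤ) - 1)) +
          (G ((ν i : ℤ) - ((i : ℕ) : ℤ) - ((j : ℕ) : ℤ))
            - t * G ((ν i : ℤ) - ((i : ℕ) : ℤ) - ((j : ℕ) : ℤ) - 1))) := by
  have h := Lfun_det (r := r) G (c + r - 1)
    (fun i => Polynomial.X ^ (c - ν i + i) * (1 - Polynomial.C t * Polynomial.X))
    (fun j => if (j : ℕ) = 0 then Polynomial.X ^ (r - 1)
      else Polynomial.X ^ (r - 1 - (j : ℕ)) + Polynomial.X ^ (r - 1 + (j : ℕ)))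
  have e1 : (Matrix.of fun i j : Fin r => Polynomial.aeval (X i : MvPolynomial (Fin r) K)
      (if (j : ℕ) = 0 then Polynomial.X ^ (r - 1)
      else Polynomial.X ^ (r - 1 - (j : ℕ)) + Polynomial.X ^ (r - 1 + (j : ℕ)) : Polynomial K))
      = Matrix.of fun i j : Fin r =>
      if (j : ℕ) = 0 then (X i : MvPolynomial (Fin r) K) ^ (r - 1)
        else X i ^ (r - 1 - j) + X i ^ (r - 1 + j) := by
    ext1 i j
    simp only [Matrix.of_apply]
    split_ifs <;> simp
  rw [e1, weyl_mv] at h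
  have e2 : (mon (fun i : Fin r => c - ν i + i) * GT t r) *
        Matrix.det (Matrix.of fun i j : Fin r => (X i : MvPolynomial (Fin r) K) ^ (r - 1 - j))
      = (∏ i, Polynomial.aeval (X i : MvPolynomial (Fin r) K)
        (Polynomial.X ^ (c - ν i + i) * (1 - Polynomial.C t * Polynomial.X))) *
        (Matrix.det (Matrix.of fun i j : Fin r => (X i : MvPolynomial (Fin r) K) ^ (r - 1 - j)) *
          ∏ i, ∏ j ∈ Ioi i, (1 - X i * X j)) := by
    simp only [mon, GT, map_mul, map_sub, map_one, map_pow, Polynomial.aeval_X, Polynomial.aeval_C,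
      Finset.prod_mul_distrib, algebraMap_eq]
    ring
  rw [Afun_apply, e2]
  refine h.trans ?_
  have key : ∀ a b : ℕ, lfun G (c + r - 1)
      (Polynomial.X ^ a * (1 - Polynomial.C t * Polynomial.X) * Polynomial.X ^ b)
      = G (c + r - 1 - a - b) - t * G (c + r - 1 - a - b - 1) := by
    intro a b
    have : (Polynomial.X ^ a * (1 - Polynomial.C t * Polynomial.X) * Polynomial.X ^ b : Polynomial K)
      = Polynomial.X ^ (a + b) - t • Polynomial.X ^ (a + b + 1) := by
      rw [Polynomial.smul_eq_C_mul]; ring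
    rw [this, map_sub, map_smul, lfun_X_pow, lfun_X_pow, smul_eq_mul]
    congr 2
    · push_cast; ring
    · congr 1; push_cast; ring
  congr 1
  ext i j
  simp only [Matrix.of_apply]
  have hi := hν i
  have hj := j.2
  split_ifs with h0
  · rw [key]
    congr 2
    · omega
    · congr 1; omega
  · rw [mul_add, map_add, key, key]
    congr 2
    · congr 1; omega
    · congr 2; omega
    · congr 1; omega
    · congr 2; omega

/-- Part (A). -/
theorem det_eq_sum_sp (t : K) (G : ℤ → K) (hG : ∀ m < 0, G m = 0) (r c : ℕ) :
    Matrix.det (Matrix.of fun i j : Fin r => G ((c : ℤ) - ((i : ℕ) : ℤ) + ((j : ℕ) : ℤ)))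
    = ∑ ν ∈ (Fintype.piFinset fun _ : Fin r => range (c + 1)).filter Antitone,
      t ^ oddColsCount c ν * Matrix.det (Matrix.of fun i j : Fin r =>
        if (j : ℕ) = 0 then
          (G ((ν i : ℤ) - ((i : ℕ) : ℤ)) - t * G ((ν i : ℤ) - ((i : ℕ) : ℤ) - 1))
        else (G ((ν i : ℤ) - ((i : ℕ) : ℤ) + ((j : ℕ) : ℤ))
            - t * G ((ν i : ℤ) - ((i : ℕ) : ℤ) + ((j : ℕ) : ℤ) - 1)) +
          (G ((ν i : ℤ) - ((i : ℕ) : ℤ) - ((j : ℕ) : ℤ))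
            - t * G ((ν i : ℤ) - ((i : ℕ) : ℤ) - ((j : ℕ) : ℤ) - 1))) := by
  rw [← Afun_delta, ← main_alt t r c _ (Afun_isAlt G _) (Afun_bound G hG c)]
  refine Finset.sum_congr rfl fun ν hν => ?_
  simp only [mem_filter, Fintype.mem_piFinset, mem_range] at hν
  rw [Afun_sp t G c ν (fun i => by have := hν.1 i; omega)]

end Func

section HP
open Polynomial
variable {R : Type} [CommRing R]

/-- `∑_k h_{m-k} t^k`. -/
def Hp (h : ℤ → R) (m : ℤ) : R[X] := ∑ k ∈ range (m + 1).toNat, C (h (m - k)) * X ^ k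

theorem Hp_neg (h : ℤ → R) (m : ℤ) (hm : m < 0) : Hp h m = 0 := by
  have : (m + 1).toNat = 0 := by omega
  rw [Hp, this, Finset.sum_range_zero]

theorem Hp_eq (h : ℤ → R) (hh : ∀ m < 0, h m = 0) (m : ℤ) (M : ℕ) (hM : m ≤ M) :
    Hp h m = ∑ k ∈ range (M + 1), C (h (m - k)) * X ^ k := by
  unfold Hp
  refine Finset.sum_subset (fun k => ?_) (fun k _ hk => ?_)
  · simp only [mem_range]; omega
  · simp only [mem_range] at hk
    rw [hh _ (by omega), map_zero, zero_mul]

theorem Hp_rec (h : ℤ → R) (hh : ∀ m < 0, h m = 0) (m : ℤ) :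
    Hp h m = C (h m) + X * Hp h (m - 1) := by
  rw [Hp_eq h hh m (m.toNat + 1) (by omega), Hp_eq h hh (m - 1) m.toNat (by omega),
    Finset.sum_range_succ', Finset.mul_sum, add_comm]
  congr 1
  · simp
  · refine Finset.sum_congr rfl fun k _ => ?_
    rw [show m - ((k + 1 : ℕ) : ℤ) = m - 1 - k by push_cast; ring]
    ring

/-- Rectangular determinant. -/
def Drect (h : ℤ → R) (r c : ℕ) : R[X] :=
  Matrix.det (Matrix.of fun i j : Fin r => Hp h ((c : ℤ) - ((i : ℕ) : ℤ) + ((j : ℕ) : ℤ)))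

theorem Drect_eq_sum_sp (h : ℤ → R) (hh : ∀ m < 0, h m = 0) (r c : ℕ) :
    Drect h r c = ∑ ν ∈ (Fintype.piFinset fun _ : Fin r => range (c + 1)).filter Antitone,
      X ^ oddColsCount c ν * C (Matrix.det (Matrix.of fun i j : Fin r =>
        if (j : ℕ) = 0 then h ((ν i : ℤ) - ((i : ℕ) : ℤ))
        else h ((ν i : ℤ) - ((i : ℕ) : ℤ) + ((j : ℕ) : ℤ)) +
          h ((ν i : ℤ) - ((i : ℕ) : ℤ) - ((j : ℕ) : ℤ)))) := by
  rw [Drect, det_eq_sum_sp X (Hp h) (Hp_neg h)]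
  refine Finset.sum_congr rfl fun ν _ => ?_
  rw [RingHom.map_det]
  congr 2
  refine Matrix.ext fun i j => ?_
  have hr : ∀ m, Hp h m - X * Hp h (m - 1) = C (h m) := fun m => by
    rw [Hp_rec h hh m]; ring
  simp only [RingHom.mapMatrix_apply, Matrix.map_apply, Matrix.of_apply, hr]
  split_ifs <;> simp

theorem Drect_coeff_sp (h : ℤ → R) (hh : ∀ m < 0, h m = 0) (r c p : ℕ) :
    (Drect h r c).coeff p = ∑ ν ∈ (Fintype.piFinset fun _ : Fin r => range (c + 1)).filter
        (fun ν => Antitone ν ∧ oddColsCount c ν = p),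
      Matrix.det (Matrix.of fun i j : Fin r =>
        if (j : ℕ) = 0 then h ((ν i : ℤ) - ((i : ℕ) : ℤ))
        else h ((ν i : ℤ) - ((i : ℕ) : ℤ) + ((j : ℕ) : ℤ)) +
          h ((ν i : ℤ) - ((i : ℕ) : ℤ) - ((j : ℕ) : ℤ))) := by
  rw [Drect_eq_sum_sp h hh, Polynomial.finsetSum_coeff, ← Finset.filter_filter,
    Finset.sum_filter (fun ν : Fin r → ℕ => oddColsCount c ν = p)]
  refine Finset.sum_congr rfl fun ν _ => ?_
  rw [Polynomial.coeff_mul_C, Polynomial.coeff_X_pow]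
  by_cases h1 : oddColsCount c ν = p
  · simp [h1]
  · rw [if_neg h1, if_neg (fun h => h1 h.symm), zero_mul]

theorem Drect_coeff_schur (h : ℤ → R) (hh : ∀ m < 0, h m = 0) (r c p : ℕ) (hr : 1 ≤ r)
    (hp : p ≤ c) :
    (Drect h r c).coeff p = Matrix.det (Matrix.of fun i j : Fin r =>
      h ((if (i : ℕ) < r - 1 then (c : ℤ) else (c : ℤ) - (p : ℤ))
        - ((i : ℕ) : ℤ) + ((j : ℕ) : ℤ))) := by
  obtain ⟨n, rfl⟩ : ∃ n, r = n + 1 := ⟨r - 1, by omega⟩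
  let Q : Matrix (Fin n) (Fin (n + 1)) R := Matrix.of fun i j =>
    h ((c : ℤ) + ((i : ℕ) : ℤ) + 1 - ((j : ℕ) : ℤ))
  have e0 : Drect h (n + 1) c = Matrix.det (Matrix.of fun i j : Fin (n + 1) =>
      Hp h ((c : ℤ) + ((i : ℕ) : ℤ) - ((j : ℕ) : ℤ))) := by
    rw [Drect, ← Matrix.det_submatrix_equiv_self Fin.revPerm]
    congr 1
    refine Matrix.ext fun i j => ?_
    simp only [Matrix.submatrix_apply, Matrix.of_apply, Fin.revPerm_apply, Fin.val_rev]
    congr 1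
    omega
  have e1 : Drect h (n + 1) c = Matrix.det (Matrix.of (Fin.cons
      (fun j : Fin (n + 1) => Hp h ((c : ℤ) - ((j : ℕ) : ℤ)))
      (fun i j => C (Q i j)) : Fin (n + 1) → Fin (n + 1) → R[X])) := by
    rw [e0]
    refine Matrix.det_eq_of_forall_row_eq_smul_add_pred (fun _ => X) ?_ ?_
    · intro j; simp
    · intro i j
      simp only [Matrix.of_apply, Fin.cons_succ, Q]
      rw [Hp_rec h hh]
      have h1 : (c : ℤ) + ((i.succ : ℕ) : ℤ) - ((j : ℕ) : ℤ)
          = c + ((i : ℕ) : ℤ) + 1 - ((j : ℕ) : ℤ) := by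
        rw [Fin.val_succ]; push_cast; ring
      have h2 : (c : ℤ) + ((i.succ : ℕ) : ℤ) - ((j : ℕ) : ℤ) - 1
          = c + ((i.castSucc : ℕ) : ℤ) - ((j : ℕ) : ℤ) := by
        rw [Fin.val_succ, Fin.val_castSucc]; push_cast; ring
      rw [h2, h1]
  have e2 : Drect h (n + 1) c = ∑ k ∈ range (c + 1), X ^ k * C (Matrix.det (Matrix.of (Fin.cons
      (fun j : Fin (n + 1) => h ((c : ℤ) - k - ((j : ℕ) : ℤ)))
      (fun i j => Q i j) : Fin (n + 1) → Fin (n + 1) → R))) := by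
    rw [e1, Matrix.det_succ_row_zero]
    have : ∀ k : ℕ, (Matrix.of (Fin.cons
      (fun j : Fin (n + 1) => h ((c : ℤ) - k - ((j : ℕ) : ℤ)))
      (fun i j => Q i j) : Fin (n + 1) → Fin (n + 1) → R)).det
      = ∑ j : Fin (n + 1), (-1) ^ (j : ℕ) * h ((c : ℤ) - k - ((j : ℕ) : ℤ)) *
        (Q.submatrix id j.succAbove).det := by
      intro k
      rw [Matrix.det_succ_row_zero]
      rfl
    simp only [this, map_sum, Finset.mul_sum]
    rw [Finset.sum_comm]
    refine Finset.sum_congr rfl fun j _ => ?_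
    have hs : ((Matrix.of (Fin.cons
      (fun j : Fin (n + 1) => Hp h ((c : ℤ) - ((j : ℕ) : ℤ)))
      (fun i j => C (Q i j)) : Fin (n + 1) → Fin (n + 1) → R[X])).submatrix Fin.succ j.succAbove).det
      = C (Q.submatrix id j.succAbove).det := by
      rw [RingHom.map_det]; rfl
    rw [hs]
    simp only [Matrix.of_apply, Fin.cons_zero]
    rw [Hp_eq h hh _ c (by omega), Finset.mul_sum, Finset.sum_mul]
    refine Finset.sum_congr rfl fun k _ => ?_
    rw [map_mul, map_mul, map_pow, map_neg, map_one,
      show (c : ℤ) - k - ((j : ℕ) : ℤ) = c - ((j : ℕ) : ℤ) - k by ring]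
    ring
  rw [e2, Polynomial.finsetSum_coeff]
  simp only [Polynomial.coeff_mul_C, Polynomial.coeff_X_pow, ite_mul, one_mul, zero_mul]
  rw [Finset.sum_ite_eq, if_pos (by simpa using Nat.lt_succ_of_le hp)]
  refine Eq.trans ?_ (Matrix.det_submatrix_equiv_self Fin.revPerm _)
  congr 1
  refine Matrix.ext fun i j => ?_
  simp only [Matrix.submatrix_apply, Matrix.of_apply, Fin.revPerm_apply]
  have hj := Fin.val_rev j
  refine Fin.cases ?_ (fun i => ?_) i
  · have hi := Fin.val_rev (0 : Fin (n + 1))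
    simp only [Fin.val_zero] at hi
    simp only [Fin.cons_zero]
    rw [if_neg (by omega)]
    congr 1
    omega
  · have hi := Fin.val_rev i.succ
    simp only [Fin.val_succ] at hi
    simp only [Fin.cons_succ, Q, Matrix.of_apply]
    rw [if_pos (by omega)]
    congr 1
    omega

end HP

section Dual
variable {K : Type} [CommRing K]

theorem finRotate_pow_val (n c : ℕ) (i : Fin n) :
    (((finRotate n) ^ c) i : ℕ) = ((i : ℕ) + c) % n := by
  cases n with
  | zero => exact i.elim0
  | succ n =>
    induction c with
    | zero => simp [Nat.mod_eq_of_lt i.2]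
    | succ c ih =>
      rw [pow_succ', Equiv.Perm.mul_apply, finRotate_apply, Fin.val_add, ih, Fin.val_one',
        ← Nat.add_mod, add_assoc]

theorem toep_mul (H F : ℤ → K) (hH : ∀ m < 0, H m = 0) (hF : ∀ m < 0, F m = 0)
    (hHF : ∀ m : ℕ, ∑ k ∈ range (m + 1), H k * F ((m : ℤ) - k) = if m = 0 then 1 else 0) (n : ℕ) :
    (Matrix.of fun i j : Fin n => H (((j : ℕ) : ℤ) - ((i : ℕ) : ℤ))) *
      (Matrix.of fun i j : Fin n => F (((j : ℕ) : ℤ) - ((i : ℕ) : ℤ))) = 1 := by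
  refine Matrix.ext fun i j => ?_
  simp only [Matrix.mul_apply, Matrix.of_apply]
  rw [Fin.sum_univ_eq_sum_range (fun k : ℕ => H ((k : ℤ) - ((i : ℕ) : ℤ)) *
    F (((j : ℕ) : ℤ) - (k : ℤ))) n]
  have hi := i.2
  have hj := j.2
  by_cases hij : (i : ℕ) ≤ j
  · obtain ⟨m, hm⟩ := Nat.exists_eq_add_of_le hij
    have h1 : ∑ k ∈ range (m + 1), H k * F ((m : ℤ) - k)
        = ∑ k ∈ range n, H ((k : ℤ) - ((i : ℕ) : ℤ)) * F (((j : ℕ) : ℤ) - (k : ℤ)) := by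
      rw [← Finset.sum_subset (s₁ := (Finset.Ico (i : ℕ) (j + 1))) (s₂ := range n)]
      · rw [Finset.sum_Ico_eq_sum_range, show (j : ℕ) + 1 - i = m + 1 by omega]
        refine Finset.sum_congr rfl fun k _ => ?_
        congr 2
        · push_cast; ring
        · rw [hm]; push_cast; ring
      · intro k; simp only [mem_Ico, mem_range]; omega
      · intro k _ hk
        simp only [mem_Ico, not_and_or] at hk
        rcases hk with hk | hk
        · rw [hH _ (by omega), zero_mul]
        · rw [hF _ (by omega), mul_zero]
    rw [← h1, hHF, Matrix.one_apply]
    congr 1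
    rw [Fin.ext_iff]
    exact propext ⟨fun h => by omega, fun h => by omega⟩
  · rw [Matrix.one_apply_ne (fun h => hij (by rw [h]))]
    refine Finset.sum_eq_zero fun k _ => ?_
    by_cases hk : (k : ℕ) < i
    · rw [hH _ (by omega), zero_mul]
    · rw [hF _ (by omega), mul_zero]

theorem toep_det (H : ℤ → K) (hH : ∀ m < 0, H m = 0) (h0 : H 0 = 1) (n : ℕ) :
    (Matrix.of fun i j : Fin n => H (((j : ℕ) : ℤ) - ((i : ℕ) : ℤ))).det = 1 := by
  rw [Matrix.det_of_isUpperTriangular]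
  · simp [h0]
  · intro i j hij
    simp only [id] at hij
    simp only [Matrix.of_apply]
    apply hH
    have := Fin.lt_def.1 hij
    omega

theorem dualJT (H E : ℤ → K) (hH : ∀ m < 0, H m = 0) (h0 : H 0 = 1) (hE : ∀ m < 0, E m = 0)
    (hHE : ∀ m : ℕ, ∑ k ∈ range (m + 1), H k * ((-1) ^ ((m : ℤ) - k).natAbs * E ((m : ℤ) - k))
      = if m = 0 then 1 else 0) (r c : ℕ) :
    Matrix.det (Matrix.of fun i j : Fin r => H ((c : ℤ) - ((i : ℕ) : ℤ) + ((j : ℕ) : ℤ)))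
    = Matrix.det (Matrix.of fun i j : Fin c => E ((r : ℤ) - ((i : ℕ) : ℤ) + ((j : ℕ) : ℤ))) := by
  set F : ℤ → K := fun m => (-1) ^ m.natAbs * E m with hFdef
  have hF : ∀ m < 0, F m = 0 := fun m hm => by simp only [hFdef]; rw [hE m hm, mul_zero]
  let T : Matrix (Fin (r + c)) (Fin (r + c)) K :=
    Matrix.of fun i j => H (((j : ℕ) : ℤ) - ((i : ℕ) : ℤ))
  let U : Matrix (Fin (r + c)) (Fin (r + c)) K :=
    Matrix.of fun i j => F (((j : ℕ) : ℤ) - ((i : ℕ) : ℤ))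
  have hTU : T * U = 1 := toep_mul H F hH hF hHE (r + c)
  have hT : T.det = 1 := toep_det H hH h0 _
  let σ : Equiv.Perm (Fin (r + c)) := (finRotate (r + c)) ^ c
  let e1 : Fin r ⊕ Fin c ≃ Fin (r + c) := finSumFinEquiv
  let e2 : Fin r ⊕ Fin c ≃ Fin (r + c) := e1.trans σ
  have v1 : ∀ i : Fin r, ((e1 (Sum.inl i) : Fin (r + c)) : ℕ) = i := fun i => by simp [e1]
  have v2 : ∀ i : Fin c, ((e1 (Sum.inr i) : Fin (r + c)) : ℕ) = r + i := fun i => by simp [e1]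
  have w1 : ∀ i : Fin r, ((e2 (Sum.inl i) : Fin (r + c)) : ℕ) = c + i := fun i => by
    simp only [e2, Equiv.trans_apply, σ]
    have := i.2
    rw [finRotate_pow_val, v1, Nat.mod_eq_of_lt (by omega)]; omega
  have w2 : ∀ i : Fin c, ((e2 (Sum.inr i) : Fin (r + c)) : ℕ) = i := fun i => by
    simp only [e2, Equiv.trans_apply, σ]
    have := i.2
    rw [finRotate_pow_val, v2, show r + (i : ℕ) + c = i + (r + c) by omega, Nat.add_mod_right,
      Nat.mod_eq_of_lt (by omega)]
  let M := T.submatrix e1 e2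
  let W := U.submatrix e2 e1
  have hMW : M * W = 1 := by
    simp only [M, W]
    rw [Matrix.submatrix_mul_equiv, hTU, Matrix.submatrix_one_equiv]
  have hσ : ((Equiv.Perm.sign σ : ℤˣ) : ℤ) = (-1) ^ (r * c) := by
    simp only [σ, map_pow]
    by_cases hc : c = 0
    · subst hc; simp
    · obtain ⟨d, rfl⟩ := Nat.exists_eq_succ_of_ne_zero hc
      rw [show r + d.succ = (r + d) + 1 from rfl, sign_finRotate]
      push_cast
      rw [← pow_mul, show (r + d) * d.succ = r * d.succ + d * (d + 1) by
        rw [Nat.succ_eq_add_one]; ring, pow_add, (Nat.even_mul_succ_self d).neg_one_pow, mul_one]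
  have hM : M.det = (-1) ^ (r * c) := by
    have : M = (T.submatrix id σ).submatrix e1 e1 := by
      simp only [M, e2, Matrix.submatrix_submatrix]
      rfl
    rw [this, Matrix.det_submatrix_equiv_self, Matrix.det_permute', hT, mul_one, hσ]
    push_cast; rfl
  have hblk : M.toBlocks₁₁ * W.toBlocks₁₂ + M.toBlocks₁₂ * W.toBlocks₂₂ = 0 ∧
      M.toBlocks₂₁ * W.toBlocks₁₂ + M.toBlocks₂₂ * W.toBlocks₂₂ = 1 := by
    have h := hMW
    rw [← Matrix.fromBlocks_toBlocks M, ← Matrix.fromBlocks_toBlocks W,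
      Matrix.fromBlocks_multiply, ← Matrix.fromBlocks_one, Matrix.fromBlocks_inj] at h
    exact ⟨h.2.1, h.2.2.2⟩
  have hMZ : M * Matrix.fromBlocks 1 W.toBlocks₁₂ 0 W.toBlocks₂₂
      = Matrix.fromBlocks M.toBlocks₁₁ 0 M.toBlocks₂₁ 1 := by
    conv_lhs => rw [← Matrix.fromBlocks_toBlocks M]
    rw [Matrix.fromBlocks_multiply, hblk.1, hblk.2]
    simp
  have hdet := congrArg Matrix.det hMZ
  rw [Matrix.det_mul, Matrix.det_fromBlocks_zero₂₁, Matrix.det_fromBlocks_zero₁₂, Matrix.det_one,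
    Matrix.det_one, one_mul, mul_one, hM] at hdet
  have hA : M.toBlocks₁₁ = Matrix.of fun i j : Fin r =>
      H ((c : ℤ) - ((i : ℕ) : ℤ) + ((j : ℕ) : ℤ)) := by
    refine Matrix.ext fun i j => ?_
    simp only [Matrix.toBlocks₁₁, M, Matrix.of_apply, Matrix.submatrix_apply, T, v1, w1]
    congr 1
    push_cast; ring
  have hW : W.toBlocks₂₂ = Matrix.of fun i j : Fin c => (-1) ^ (i : ℕ) * (Matrix.of fun i j : Fin c =>
      (-1) ^ (r + (j : ℕ)) * (Matrix.of fun i j : Fin c =>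
        E ((r : ℤ) - ((i : ℕ) : ℤ) + ((j : ℕ) : ℤ))) i j) i j := by
    refine Matrix.ext fun i j => ?_
    simp only [Matrix.toBlocks₂₂, W, Matrix.of_apply, Matrix.submatrix_apply, U, v2, w2, hFdef]
    rw [← mul_assoc, ← pow_add]
    congr 1
    · rw [neg_one_pow_eq_pow_mod_two, neg_one_pow_eq_pow_mod_two (n := (i : ℕ) + (r + j))]
      congr 1
      omega
    · congr 1; push_cast; ring
  rw [← hA, ← hdet, hW, Matrix.det_mul_column, Matrix.det_mul_row]
  simp only [pow_add, Finset.prod_mul_distrib, Finset.prod_const, Finset.card_univ,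
    Fintype.card_fin, ← pow_mul]
  rw [Finset.prod_pow_eq_pow_sum]
  have hs : ∀ s : ℕ, ((-1 : K) ^ s) * (-1) ^ s = 1 := fun s => by
    rw [← mul_pow]; simp
  linear_combination (Matrix.det (Matrix.of fun i j : Fin c =>
    E ((r : ℤ) - ((i : ℕ) : ℤ) + ((j : ℕ) : ℤ)))) *
      ((-1) ^ (∑ i : Fin c, (i : ℕ)) * (-1) ^ (∑ i : Fin c, (i : ℕ)) * hs (r * c) +
        hs (∑ i : Fin c, (i : ℕ)))

end Dual

section HSer
variable {R : Type} [CommRing R]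

theorem comp_neg_X_coeff' (p : Polynomial R) (n : ℕ) :
    (p.comp (-Polynomial.X)).coeff n = (-1) ^ n * p.coeff n := by
  have h : (-Polynomial.X : Polynomial R) = Polynomial.C (-1) * Polynomial.X := by simp
  rw [h, Polynomial.comp_C_mul_X_coeff, mul_comm]

theorem hpoly_nat {N : ℕ} (x : Fin N → R) (m : ℕ) : hpoly x (m : ℤ)
    = ∑ f ∈ Finset.univ.filter (fun f : Fin m → Fin N => Monotone f), ∏ i, x (f i) := by
  unfold hpoly
  rw [if_pos (by omega)]
  rfl

theorem hpoly_neg {N : ℕ} (x : Fin N → R) (m : ℤ) (hm : m < 0) : hpoly x m = 0 := by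
  unfold hpoly
  rw [if_neg (by omega)]

theorem hpoly_zero {N : ℕ} (x : Fin N → R) : hpoly x ((0 : ℕ) : ℤ) = 1 := by
  have h : ∀ f ∈ (univ : Finset (Fin 0 → Fin N)), Monotone f := fun f _ i => i.elim0
  rw [hpoly_nat, Finset.filter_true_of_mem h]
  simp

theorem hpoly_succ_empty (x : Fin 0 → R) (m : ℕ) : hpoly x ((m + 1 : ℕ) : ℤ) = 0 := by
  rw [hpoly_nat]
  refine Finset.sum_eq_zero fun f _ => (f 0).elim0

theorem hpoly_rec {N : ℕ} (x : Fin (N + 1) → R) (m : ℕ) : hpoly x ((m + 1 : ℕ) : ℤ)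
    = hpoly (fun i : Fin N => x i.succ) ((m + 1 : ℕ) : ℤ) + x 0 * hpoly x (m : ℤ) := by
  rw [hpoly_nat, hpoly_nat, hpoly_nat,
    ← Finset.sum_filter_add_sum_filter_not _ (fun f : Fin (m + 1) → Fin (N + 1) => f 0 ≠ 0)]
  congr 1
  · symm
    refine Finset.sum_bij (fun g _ => fun i => (g i).succ) ?_ ?_ ?_ ?_
    · intro g hg
      simp only [mem_filter, mem_univ, true_and] at hg ⊢
      exact ⟨fun i j hij => Fin.succ_le_succ_iff.2 (hg hij), Fin.succ_ne_zero _⟩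
    · intro g _ g' _ h
      funext i
      exact Fin.succ_injective _ (congrFun h i)
    · intro f hf
      simp only [mem_filter, mem_univ, true_and] at hf
      have hne : ∀ i, f i ≠ 0 := fun i h => hf.2 (by
        have := hf.1 (Fin.zero_le i)
        rw [h] at this
        exact Fin.le_zero_iff.1 this)
      refine ⟨fun i => (f i).pred (hne i), ?_, ?_⟩
      · simp only [mem_filter, mem_univ, true_and]
        intro i j hij
        exact Fin.pred_le_pred_iff.2 (hf.1 hij)
      · funext i; simp
    · intro g _; rfl
  · rw [Finset.mul_sum]
    symm
    refine Finset.sum_bij (fun g _ => (Fin.cons 0 g : Fin (m + 1) → Fin (N + 1))) ?_ ?_ ?_ ?_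
    · intro g hg
      simp only [mem_filter, mem_univ, true_and] at hg ⊢
      refine ⟨?_, by simp⟩
      intro i j
      refine Fin.cases ?_ (fun i' => ?_) i
      · intro _; simp
      · refine Fin.cases ?_ (fun j' => ?_) j
        · intro h; simp at h
        · intro h; simpa using hg (Fin.succ_le_succ_iff.1 h)
    · intro g _ g' _ h
      exact Fin.cons_right_injective (α := fun _ => Fin (N + 1)) 0 h
    · intro f hf
      simp only [mem_filter, mem_univ, true_and, not_not] at hf
      refine ⟨fun i => f i.succ, ?_, ?_⟩
      · simp only [mem_filter, mem_univ, true_and]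
        intro i j hij
        exact hf.1 (Fin.succ_le_succ_iff.2 hij)
      · funext i
        refine Fin.cases ?_ (fun i' => ?_) i
        · simp [hf.2]
        · simp
    · intro g _
      rw [Fin.prod_univ_succ]
      simp

open PowerSeries in
theorem hser_mul {N : ℕ} (x : Fin N → R) :
    (PowerSeries.mk fun m => hpoly x (m : ℤ)) *
      ∏ i, (1 - PowerSeries.C (x i) * PowerSeries.X) = 1 := by
  induction N with
  | zero =>
    rw [Fin.prod_univ_zero, mul_one]
    ext m
    rw [coeff_mk, coeff_one]
    cases m with
    | zero => rw [hpoly_zero]; simp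
    | succ m => rw [hpoly_succ_empty]; simp
  | succ N ih =>
    rw [Fin.prod_univ_succ, ← mul_assoc]
    refine Eq.trans ?_ (ih (fun i => x i.succ))
    congr 1
    ext m
    rw [mul_sub, mul_one, mul_comm (PowerSeries.C (x 0)), ← mul_assoc, map_sub, coeff_mul_C, coeff_mk]
    cases m with
    | zero => rw [coeff_zero_mul_X, zero_mul, sub_zero, coeff_mk, hpoly_zero, hpoly_zero]
    | succ m => rw [coeff_succ_mul_X, coeff_mk, coeff_mk, hpoly_rec]; ring

open Polynomial in
/-- `∏ (1 + x_i X)`. -/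
def epoly {N : ℕ} (x : Fin N → R) : R[X] := ∏ i, (1 + C (x i) * X)

/-- Elementary symmetric functions, integer indexed. -/
def esy {N : ℕ} (x : Fin N → R) (m : ℤ) : R := if 0 ≤ m then (epoly x).coeff m.toNat else 0

theorem esy_neg {N : ℕ} (x : Fin N → R) (m : ℤ) (hm : m < 0) : esy x m = 0 := by
  unfold esy
  rw [if_neg (by omega)]

theorem esy_nat {N : ℕ} (x : Fin N → R) (m : ℕ) : esy x (m : ℤ) = (epoly x).coeff m := by
  unfold esy
  rw [if_pos (by omega)]
  rfl

open Polynomial in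
theorem epoly_comp_coe {N : ℕ} (x : Fin N → R) :
    (((epoly x).comp (-X) : R[X]) : PowerSeries R)
      = ∏ i, (1 - PowerSeries.C (x i) * PowerSeries.X) := by
  unfold epoly
  rw [Polynomial.prod_comp, ← Polynomial.coeToPowerSeries.ringHom_apply, map_prod]
  refine Finset.prod_congr rfl fun i _ => ?_
  simp [Polynomial.coeToPowerSeries.ringHom_apply]
  ring

/-- `E_m = e_m + t e_{m-1}`. -/
def Ep {N : ℕ} (x : Fin N → R) (m : ℤ) : Polynomial R :=
  Polynomial.C (esy x m) + Polynomial.X * Polynomial.C (esy x (m - 1))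

theorem Ep_neg {N : ℕ} (x : Fin N → R) (m : ℤ) (hm : m < 0) : Ep x m = 0 := by
  unfold Ep
  rw [esy_neg x m hm, esy_neg x _ (by omega)]
  simp

theorem Hp_Ep {N : ℕ} (x : Fin N → R) (m : ℕ) :
    ∑ k ∈ range (m + 1), Hp (hpoly x) k * ((-1) ^ ((m : ℤ) - k).natAbs * Ep x ((m : ℤ) - k))
      = if m = 0 then 1 else 0 := by
  let φ : PowerSeries R →+* PowerSeries (Polynomial R) := PowerSeries.map Polynomial.C
  let hs : PowerSeries R := PowerSeries.mk fun m => hpoly x (m : ℤ)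
  let es : PowerSeries R := (((epoly x).comp (-Polynomial.X) : Polynomial R) : PowerSeries R)
  let t : PowerSeries (Polynomial R) := PowerSeries.C Polynomial.X
  have h1 : (PowerSeries.mk fun m : ℕ => Hp (hpoly x) m) * (1 - t * PowerSeries.X) = φ hs := by
    ext1 m
    rw [mul_sub, mul_one, mul_comm t, ← mul_assoc, map_sub, PowerSeries.coeff_mul_C,
      PowerSeries.coeff_mk, PowerSeries.coeff_map, PowerSeries.coeff_mk,
      Hp_rec _ (hpoly_neg x)]
    cases m with
    | zero =>
      rw [PowerSeries.coeff_zero_mul_X, zero_mul, Hp_neg _ _ (by simp)]; simp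
    | succ m =>
      rw [PowerSeries.coeff_succ_mul_X, PowerSeries.coeff_mk,
        show ((m + 1 : ℕ) : ℤ) - 1 = m by push_cast; ring]
      ring
  have h2 : (1 - t * PowerSeries.X) * φ es
      = PowerSeries.mk fun m : ℕ => (-1) ^ m * Ep x m := by
    ext1 m
    rw [sub_mul, one_mul, mul_assoc, map_sub, PowerSeries.coeff_C_mul, PowerSeries.coeff_mk,
      PowerSeries.coeff_map, Polynomial.coeff_coe, comp_neg_X_coeff', Ep, esy_nat]
    cases m with
    | zero => rw [PowerSeries.coeff_zero_X_mul, esy_neg _ _ (by simp)]; simp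
    | succ m =>
      rw [PowerSeries.coeff_succ_X_mul, PowerSeries.coeff_map, Polynomial.coeff_coe,
        comp_neg_X_coeff', show ((m + 1 : ℕ) : ℤ) - 1 = m by push_cast; ring, esy_nat]
      simp only [map_mul, map_pow, map_neg, map_one]
      ring
  have h3 : (PowerSeries.mk fun m : ℕ => Hp (hpoly x) m) *
      (PowerSeries.mk fun m : ℕ => (-1) ^ m * Ep x m) = 1 := by
    rw [← h2, ← mul_assoc, h1, ← map_mul, ← map_one φ]
    congr 1
    simp only [hs, es]
    rw [epoly_comp_coe, hser_mul]
  have h4 := congrArg (PowerSeries.coeff m) h3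
  rw [PowerSeries.coeff_mul, PowerSeries.coeff_one,
    Finset.Nat.sum_antidiagonal_eq_sum_range_succ_mk] at h4
  rw [← h4]
  refine Finset.sum_congr rfl fun k hk => ?_
  have hk : k ≤ m := by have := Finset.mem_range.1 hk; omega
  simp only [PowerSeries.coeff_mk]
  rw [show (m : ℤ) - k = ((m - k : ℕ) : ℤ) by omega, Int.natAbs_natCast]

theorem Drect_dual {N : ℕ} (x : Fin N → R) (r c : ℕ) :
    Drect (hpoly x) r c
      = Matrix.det (Matrix.of fun i j : Fin c => Ep x ((r : ℤ) - ((i : ℕ) : ℤ) + ((j : ℕ) : ℤ))) := by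
  refine dualJT (Hp (hpoly x)) (Ep x) (Hp_neg _) ?_ (Ep_neg x) (Hp_Ep x) r c
  rw [Hp_rec _ (hpoly_neg x), Hp_neg _ _ (by simp)]
  have := hpoly_zero x
  simp only [Nat.cast_zero] at this
  rw [this]; simp

end HSer

section Pal
open Polynomial
variable {R : Type} [CommRing R]

/-- Palindromic polynomials. -/
def Pal (N : ℕ) (q : R[X]) : Prop := q.natDegree ≤ N ∧ q.reflect N = q

theorem Pal.mul {M N : ℕ} {p q : R[X]} (hp : Pal M p) (hq : Pal N q) : Pal (M + N) (p * q) :=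
  ⟨natDegree_mul_le.trans (add_le_add hp.1 hq.1), by rw [reflect_mul _ _ hp.1 hq.1, hp.2, hq.2]⟩

theorem pal_one : Pal 0 (1 : R[X]) := ⟨by simp, by simp⟩

theorem pal_lin : Pal 1 (1 + C 1 * X : R[X]) := by
  constructor
  · compute_degree
  · rw [map_one, one_mul, reflect_add, reflect_one_X, reflect_one, pow_one, add_comm]

theorem pal_quad (y : Rˣ) : Pal 2 ((1 + C (y : R) * X) * (1 + C ((y⁻¹ : Rˣ) : R) * X)) := by
  have h : (1 + C (y : R) * X) * (1 + C ((y⁻¹ : Rˣ) : R) * X)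
      = C 1 * X ^ 0 + C (y + ((y⁻¹ : Rˣ) : R)) * X ^ 1 + C 1 * X ^ 2 := by
    have : C (y : R) * C ((y⁻¹ : Rˣ) : R) = 1 := by rw [← map_mul, Units.mul_inv, map_one]
    rw [map_add, map_one]
    linear_combination (X ^ 2) * this
  rw [h]
  constructor
  · compute_degree
  · rw [reflect_add, reflect_add, reflect_C_mul_X_pow, reflect_C_mul_X_pow, reflect_C_mul_X_pow,
      revAt_le (by omega), revAt_le (by omega), revAt_le (by omega)]
    ring

theorem pal_range (y : ℕ → Rˣ) (n : ℕ) : Pal (2 * n) (∏ k ∈ range (2 * n),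
    (1 + C (if k % 2 = 0 then (y (k / 2) : R) else ((y (k / 2))⁻¹ : Rˣ)) * X)) := by
  induction n with
  | zero => simpa using pal_one
  | succ n ih =>
    rw [show 2 * (n + 1) = 2 * n + 1 + 1 by ring, Finset.prod_range_succ, Finset.prod_range_succ,
      mul_assoc]
    have h1 : (2 * n) % 2 = 0 := by omega
    have h2 : ¬ (2 * n + 1) % 2 = 0 := by omega
    have h3 : (2 * n) / 2 = n := by omega
    have h4 : (2 * n + 1) / 2 = n := by omega
    rw [if_pos h1, if_neg h2, h3, h4]
    exact ih.mul (pal_quad (y n))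

theorem pal_xpm (N : ℕ) (x : Fin (N / 2) → Rˣ) : Pal N (epoly (xpm (N / 2) N x)) := by
  let y : ℕ → Rˣ := fun i => if h : i < N / 2 then x ⟨i, h⟩ else 1
  have h : epoly (xpm (N / 2) N x) = ∏ k ∈ range N,
      (1 + C (if k % 2 = 0 then (y (k / 2) : R) else ((y (k / 2))⁻¹ : Rˣ)) * X) := by
    rw [epoly, ← Fin.prod_univ_eq_prod_range (fun k : ℕ =>
      (1 + C (if k % 2 = 0 then (y (k / 2) : R) else ((y (k / 2))⁻¹ : Rˣ)) * X)) N]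
    refine Finset.prod_congr rfl fun k _ => ?_
    congr 3
    simp only [xpm, y]
    split_ifs <;> simp
  rw [h]
  rcases Nat.even_or_odd' N with ⟨n, hn | hn⟩
  · rw [hn]; exact pal_range y n
  · have hy : y n = 1 := by simp only [y]; rw [dif_neg (by omega)]
    rw [hn, Finset.prod_range_succ]
    have h1 : (2 * n) % 2 = 0 := by omega
    have h3 : (2 * n) / 2 = n := by omega
    rw [if_pos h1, h3, hy, Units.val_one]
    exact (pal_range y n).mul pal_lin

theorem esy_pal (N : ℕ) (x : Fin (N / 2) → Rˣ) (m : ℤ) :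
    esy (xpm (N / 2) N x) (N - m) = esy (xpm (N / 2) N x) m := by
  obtain ⟨hd, hp⟩ := pal_xpm N x
  have hbig : ∀ m : ℤ, (N : ℤ) < m → esy (xpm (N / 2) N x) m = 0 := by
    intro m hm
    obtain ⟨k, rfl⟩ := Int.eq_ofNat_of_zero_le (show 0 ≤ m by omega)
    rw [esy_nat, coeff_eq_zero_of_natDegree_lt (by omega)]
  by_cases h0 : m < 0
  · rw [esy_neg _ m h0, hbig _ (by omega)]
  by_cases h1 : (N : ℤ) < m
  · rw [hbig m h1, esy_neg _ _ (by omega)]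
  obtain ⟨k, rfl⟩ := Int.eq_ofNat_of_zero_le (show 0 ≤ m by omega)
  rw [show (N : ℤ) - k = ((N - k : ℕ) : ℤ) by omega, esy_nat, esy_nat]
  conv_rhs => rw [← hp]
  rw [coeff_reflect, revAt_le (by omega)]

theorem reflect_one_Ep {N : ℕ} (x : Fin N → R) (m : ℤ) :
    reflect 1 (Ep x m) = C (esy x (m - 1)) + X * C (esy x m) := by
  unfold Ep
  rw [reflect_add, mul_comm X, reflect_C_mul, reflect_one_X, reflect_C, pow_one]
  ring

theorem Ep_rev (N : ℕ) (x : Fin (N / 2) → Rˣ) (m : ℤ) :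
    Ep (xpm (N / 2) N x) (N + 1 - m) = reflect 1 (Ep (xpm (N / 2) N x) m) := by
  rw [reflect_one_Ep, Ep, show (N : ℤ) + 1 - m = N - (m - 1) by ring, esy_pal,
    show (N : ℤ) - (m - 1) - 1 = N - m by ring, esy_pal]

theorem Ep_natDegree {N : ℕ} (x : Fin N → R) (m : ℤ) : (Ep x m).natDegree ≤ 1 := by
  unfold Ep
  compute_degree

theorem reflect_prod_one {ι : Type} (s : Finset ι) (f : ι → R[X]) (hf : ∀ i, (f i).natDegree ≤ 1) :
    reflect s.card (∏ i ∈ s, f i) = ∏ i ∈ s, reflect 1 (f i) := by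
  induction s using Finset.induction_on with
  | empty => simp
  | insert a s ha ih =>
    rw [Finset.prod_insert ha, Finset.prod_insert ha, Finset.card_insert_of_notMem ha, add_comm,
      reflect_mul _ _ (hf a) ?_, ih]
    refine (natDegree_prod_le _ _).trans ?_
    refine (Finset.sum_le_sum (fun i _ => hf i)).trans ?_
    simp

theorem reflect_sum' {ι : Type} (s : Finset ι) (n : ℕ) (f : ι → R[X]) :
    reflect n (∑ i ∈ s, f i) = ∑ i ∈ s, reflect n (f i) := by
  induction s using Finset.induction_on with
  | empty => simp
  | insert a s ha ih => rw [Finset.sum_insert ha, Finset.sum_insert ha, reflect_add, ih]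

theorem reflect_det {c : ℕ} (M : Matrix (Fin c) (Fin c) R[X]) (hM : ∀ i j, (M i j).natDegree ≤ 1) :
    (Matrix.of fun i j => reflect 1 (M i j)).det = reflect c M.det := by
  rw [Matrix.det_apply', Matrix.det_apply', reflect_sum']
  refine Finset.sum_congr rfl fun σ _ => ?_
  have : (((Equiv.Perm.sign σ : ℤˣ) : ℤ) : R[X]) = C (((Equiv.Perm.sign σ : ℤˣ) : ℤ) : R) := by
    simp
  rw [this, reflect_C_mul]
  congr 1
  have h := reflect_prod_one univ (fun i => M (σ i) i) (fun i => hM _ _)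
  rw [Finset.card_univ, Fintype.card_fin] at h
  rw [h]
  rfl

/-- Part (B). -/
theorem Drect_coeff_rev (N r c p : ℕ) (hrN : r ≤ N) (hp : p ≤ c) (x : Fin (N / 2) → Rˣ) :
    (Drect (hpoly (xpm (N / 2) N x)) r c).coeff p
      = (Drect (hpoly (xpm (N / 2) N x)) (N - r + 1) c).coeff (c - p) := by
  rw [Drect_dual, Drect_dual]
  have h := reflect_det (Matrix.of fun i j : Fin c =>
    Ep (xpm (N / 2) N x) ((r : ℤ) - ((i : ℕ) : ℤ) + ((j : ℕ) : ℤ))) (fun i j => Ep_natDegree _ _)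
  have h2 : (Matrix.of fun i j : Fin c => Ep (xpm (N / 2) N x)
      (((N - r + 1 : ℕ) : ℤ) - ((i : ℕ) : ℤ) + ((j : ℕ) : ℤ))).det
      = (Matrix.of fun i j => reflect 1 ((Matrix.of fun i j : Fin c =>
    Ep (xpm (N / 2) N x) ((r : ℤ) - ((i : ℕ) : ℤ) + ((j : ℕ) : ℤ))) i j)).det := by
    rw [← Matrix.det_transpose]
    congr 1
    refine Matrix.ext fun i j => ?_
    simp only [Matrix.transpose_apply, Matrix.of_apply]
    rw [← Ep_rev]
    congr 1
    omega
  rw [h2, h, coeff_reflect, revAt_le (by omega)]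
  congr 1
  omega

end Pal

/-- branching of `s_N((c^{r-1}, c-p); x^{±1})` into symplectic
characters `sp_N`. -/
theorem schurLaurent_eq_sum_spCharLaurent
    (N r c p : ℕ) (hN : 1 ≤ N) (hr : 1 ≤ r) (hrN : r ≤ N) (hcp : p ≤ c)
    (R : Type) [CommRing R] (x : Fin (N / 2) → Rˣ) :
    (r ≤ (N + 1) / 2 →
      schur (fun i : Fin r => if (i : ℕ) < r - 1 then (c : ℤ) else (c : ℤ) - (p : ℤ))
          (xpm (N / 2) N x)
        = ∑ ν ∈ ((Fintype.piFinset fun _ : Fin r => Finset.range (c + 1)).filter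
              (fun ν => Antitone ν ∧ oddColsCount c ν = p)),
            spChar (fun i => (ν i : ℤ)) (xpm (N / 2) N x)) ∧
    ((N + 1) / 2 < r →
      schur (fun i : Fin r => if (i : ℕ) < r - 1 then (c : ℤ) else (c : ℤ) - (p : ℤ))
          (xpm (N / 2) N x)
        = ∑ ν ∈ ((Fintype.piFinset fun _ : Fin (N - r + 1) => Finset.range (c + 1)).filter
              (fun ν => Antitone ν ∧ oddColsCount c ν = c - p)),
            spChar (fun i => (ν i : ℤ)) (xpm (N / 2) N x)) := by
  have hh := hpoly_neg (xpm (N / 2) N x)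
  have hs := Drect_coeff_schur (hpoly (xpm (N / 2) N x)) hh r c p hr hcp
  constructor
  · intro _
    refine hs.symm.trans ?_
    exact Drect_coeff_sp _ hh r c p
  · intro _
    refine hs.symm.trans ?_
    rw [Drect_coeff_rev N r c p hrN hcp x]
    exact Drect_coeff_sp _ hh (N - r + 1) c (c - p)

end
end
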